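/- Let d ≥ 2 be an integer and let r be purely imaginary. Then lim_{t→0⁺} t·Ψ^d(r,−r,t) = 3 · 2^{4−d} · π² · Γ(d−1) · Γ((d−1)/2−3r) · Γ((d−1)/2+3r), where the limit is over real t decreasing to 0. -/

import Mathlib

open Complex Real Set MeasureTheory Finset

/-- The beta function `B(u,v) = Γ(u)Γ(v)/Γ(u+v)`. -/
noncomputable def cBeta (u v : ℂ) : ℂ := Complex.Gamma u * Complex.Gamma v / Complex.Gamma (u + v)

/-- The completed Whittaker function `W^{d*}_{m'}(y, r)`, defined via its Mellin-Barnes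
integral with the contours placed at `σ₁ = σ₂ = 1`. -/
noncomputable def Wstar (d : ℕ) (r : ℂ) (y₁ y₂ : ℝ) (m' : ℤ) : ℂ :=
  ((2 : ℂ) ^ (d + 1) * (Real.pi : ℂ))⁻¹ *
    (Real.sqrt ((2 * d).choose (d + m'.natAbs)) : ℂ) *
    ∑ ℓ ∈ Finset.range (m'.natAbs + 1),
      (if 0 ≤ m' then (1 : ℂ) else -1) ^ ℓ * ((m'.natAbs).choose ℓ : ℂ) *
        (((2 * Real.pi : ℝ) : ℂ))⁻¹ ^ 2 *
          ∫ t : ℝ × ℝ,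
            ((2 * Real.pi * y₁ : ℝ) : ℂ) ^ (1 - ((1 : ℂ) + Complex.I * t.1)) *
              ((2 * Real.pi * y₂ : ℝ) : ℂ) ^ (1 - ((1 : ℂ) + Complex.I * t.2)) *
                Complex.Gamma (((d : ℂ) - 1) / 2 + ((1 : ℂ) + Complex.I * t.1) - r) *
                  Complex.Gamma (((d : ℂ) - 1) / 2 + ((1 : ℂ) + Complex.I * t.2) + r) *
                    cBeta (((d : ℂ) - (m'.natAbs : ℂ) + ((1 : ℂ) + Complex.I * t.1) + 2 * r) / 2)
                      (((ℓ : ℂ) + ((1 : ℂ) + Complex.I * t.2) - 2 * r) / 2)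

/-- The Rankin-Selberg local zeta integral `Ψ^d(r, r', t)`. -/
noncomputable def Psi (d : ℕ) (r r' t : ℂ) : ℂ :=
  ∫ y₁ in Set.Ioi (0 : ℝ), ∫ y₂ in Set.Ioi (0 : ℝ),
    (∑ m' ∈ Finset.Icc (-(d : ℤ)) (d : ℤ), Wstar d r y₁ y₂ m' * Wstar d r' y₁ y₂ m') *
      ((y₁ ^ 2 * y₂ : ℝ) : ℂ) ^ t / ((y₁ * y₂ : ℝ) : ℂ) ^ 3

/-- The cosine of the angle in `(0, π/2)` whose tangent is `exp a`. -/
noncomputable def expCos (a : ℝ) : ℝ := (√(1 + Real.exp (2 * a)))⁻¹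

lemma expCos_pos (a : ℝ) : 0 < expCos a := by
  unfold expCos; positivity

lemma continuous_expCos : Continuous expCos := by
  unfold expCos
  refine Continuous.inv₀ (by fun_prop) fun a => ?_
  positivity

lemma expCos_sq (a : ℝ) : expCos a ^ 2 = (1 + Real.exp (2 * a))⁻¹ := by
  unfold expCos
  rw [inv_pow, Real.sq_sqrt (by positivity)]

lemma expCos_neg (a : ℝ) : expCos (-a) = Real.exp a * expCos a := by
  refine (pow_left_inj₀ (expCos_pos _).le (mul_pos (Real.exp_pos _) (expCos_pos _)).le
    two_ne_zero).1 ?_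
  rw [mul_pow, expCos_sq, expCos_sq, mul_neg, Real.exp_neg, two_mul, Real.exp_add]
  have := Real.exp_pos a
  field_simp
  ring

lemma expCos_sq_add_sq (a : ℝ) : expCos a ^ 2 + expCos (-a) ^ 2 = 1 := by
  rw [expCos_neg, mul_pow, expCos_sq, two_mul, Real.exp_add]
  have := Real.exp_pos a
  field_simp

lemma expCos_le_one (a : ℝ) : expCos a ≤ 1 := by
  nlinarith [expCos_sq_add_sq a, sq_nonneg (expCos (-a)), expCos_pos a]

lemma expCos_le_exp_neg (a : ℝ) : expCos a ≤ Real.exp (-a) := by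
  have h := expCos_neg (-a)
  rw [neg_neg] at h
  rw [h]
  exact mul_le_of_le_one_right (Real.exp_pos _).le (expCos_le_one _)

lemma tendsto_expCos_atBot : Filter.Tendsto expCos Filter.atBot (nhds 1) := by
  have h : Filter.Tendsto (fun a : ℝ => Real.exp (2 * a)) Filter.atBot (nhds 0) :=
    Real.tendsto_exp_atBot.comp (Filter.tendsto_id.const_mul_atBot two_pos)
  have h2 : Filter.Tendsto (fun a : ℝ => (√(1 + Real.exp (2 * a)))⁻¹) Filter.atBot
      (nhds (√(1 + 0))⁻¹) := ((h.const_add 1).sqrt).inv₀ (by simp)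
  simp only [add_zero, Real.sqrt_one, inv_one] at h2
  exact h2

lemma hasDerivAt_expCos_sq (a : ℝ) :
    HasDerivAt (fun a => expCos a ^ 2) (-(2 * (expCos a ^ 2 * expCos (-a) ^ 2))) a := by
  simp_rw [expCos_sq]
  have h : HasDerivAt (fun a : ℝ => 1 + Real.exp (2 * a)) (Real.exp (2 * a) * (2 * 1)) a :=
    (((hasDerivAt_id a).const_mul 2).exp).const_add 1
  refine (h.inv (by positivity)).congr_deriv ?_
  rw [mul_neg, Real.exp_neg]
  have := Real.exp_pos (2 * a)
  field_simp
  ring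

lemma expCos_sq_injective : Function.Injective fun a => expCos a ^ 2 := by
  intro a b h
  simp only [expCos_sq, inv_inj, add_right_inj, Real.exp_eq_exp] at h
  linarith

lemma image_expCos_sq : (fun a => expCos a ^ 2) '' univ = Set.Ioo 0 1 := by
  ext x
  simp only [image_univ, Set.mem_range, Set.mem_Ioo, expCos_sq]
  constructor
  · rintro ⟨a, rfl⟩
    have := Real.exp_pos (2 * a)
    exact ⟨by positivity, inv_lt_one_of_one_lt₀ (by linarith)⟩
  · rintro ⟨h0, h1⟩
    refine ⟨Real.log (x⁻¹ - 1) / 2, ?_⟩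
    have : 0 < x⁻¹ - 1 := by
      have := one_lt_inv_iff₀.2 ⟨h0, h1⟩
      linarith
    rw [mul_div_cancel₀ _ two_ne_zero, Real.exp_log this]
    simp

lemma ofReal_sq_cpow {x : ℝ} (hx : 0 < x) (u : ℂ) : ((x ^ 2 : ℝ) : ℂ) ^ u = (x : ℂ) ^ (2 * u) := by
  have h : ((x ^ 2 : ℝ) : ℂ) ≠ 0 := by exact_mod_cast (pow_pos hx 2).ne'
  rw [cpow_def_of_ne_zero h, cpow_def_of_ne_zero (by exact_mod_cast hx.ne'),
    ← Complex.ofReal_log (by positivity), ← Complex.ofReal_log hx.le, Real.log_pow]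
  push_cast
  ring_nf

lemma betaIntegrand_comp_expCos_sq (u v : ℂ) (a : ℝ) :
    |-(2 * (expCos a ^ 2 * expCos (-a) ^ 2))| •
      (((expCos a ^ 2 : ℝ) : ℂ) ^ (u - 1) * (1 - ((expCos a ^ 2 : ℝ) : ℂ)) ^ (v - 1)) =
    2 * ((expCos a : ℂ) ^ (2 * u) * (expCos (-a) : ℂ) ^ (2 * v)) := by
  have h1 : (1 : ℂ) - ((expCos a ^ 2 : ℝ) : ℂ) = ((expCos (-a) ^ 2 : ℝ) : ℂ) := by
    have := expCos_sq_add_sq a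
    rw [← Complex.ofReal_one, ← this]; push_cast; ring
  have ha := expCos_pos a
  have hb := expCos_pos (-a)
  rw [h1, abs_neg, abs_of_pos (by positivity), ← ofReal_sq_cpow ha, ← ofReal_sq_cpow hb,
    cpow_sub _ _ (by exact_mod_cast (pow_pos ha 2).ne'),
    cpow_sub _ _ (by exact_mod_cast (pow_pos hb 2).ne'), cpow_one, cpow_one, Complex.real_smul]
  have ha' : (expCos a : ℂ) ≠ 0 := by exact_mod_cast ha.ne'
  have hb' : (expCos (-a) : ℂ) ≠ 0 := by exact_mod_cast hb.ne'
  push_cast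
  field_simp

lemma integrable_expCos_cpow {u v : ℂ} (hu : 0 < u.re) (hv : 0 < v.re) :
    Integrable fun a : ℝ => (expCos a : ℂ) ^ (2 * u) * (expCos (-a) : ℂ) ^ (2 * v) := by
  have h := Complex.betaIntegral_convergent hu hv
  rw [intervalIntegrable_iff_integrableOn_Ioo_of_le zero_le_one, ← image_expCos_sq,
    integrableOn_image_iff_integrableOn_abs_deriv_smul MeasurableSet.univ
      (fun a _ => (hasDerivAt_expCos_sq a).hasDerivWithinAt) expCos_sq_injective.injOn,
    integrableOn_univ] at h
  simp_rw [betaIntegrand_comp_expCos_sq] at h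
  simpa using h.const_mul 2⁻¹

lemma cBeta_eq_integral {u v : ℂ} (hu : 0 < u.re) (hv : 0 < v.re) :
    cBeta u v = 2 * ∫ a : ℝ, (expCos a : ℂ) ^ (2 * u) * (expCos (-a) : ℂ) ^ (2 * v) := by
  rw [cBeta, Complex.Gamma_mul_Gamma_eq_betaIntegral hu hv,
    mul_div_cancel_left₀ _ (Complex.Gamma_ne_zero_of_re_pos (by simpa using add_pos hu hv)),
    Complex.betaIntegral, intervalIntegral.integral_of_le zero_le_one,
    integral_Ioc_eq_integral_Ioo, ← image_expCos_sq,
    integral_image_eq_integral_abs_deriv_smul MeasurableSet.univ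
      (fun a _ => (hasDerivAt_expCos_sq a).hasDerivWithinAt) expCos_sq_injective.injOn,
    setIntegral_univ]
  simp_rw [betaIntegrand_comp_expCos_sq]
  exact integral_const_mul _ _

lemma norm_Gamma_le_Gamma_re {z : ℂ} (hz : 0 < z.re) : ‖Complex.Gamma z‖ ≤ Real.Gamma z.re := by
  rw [Complex.Gamma_eq_integral hz, Real.Gamma_eq_integral hz, Complex.GammaIntegral]
  refine (norm_integral_le_integral_norm _).trans_eq ?_
  refine setIntegral_congr_fun measurableSet_Ioi fun x hx => ?_
  rw [norm_mul, Complex.norm_real, Complex.norm_cpow_eq_rpow_re_of_pos hx, Real.norm_eq_abs,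
    Real.abs_exp]
  simp

lemma continuous_Gamma_vertical {A : ℂ} (hA : 0 < A.re) :
    Continuous fun t : ℝ => Complex.Gamma (A + I * t) := by
  refine continuous_iff_continuousAt.2 fun t => ?_
  have h : ContinuousAt Complex.Gamma (A + I * t) := by
    refine (Complex.differentiableAt_Gamma _ fun m h => ?_).continuousAt
    have := congrArg Complex.re h
    simp at this
    have : (0 : ℝ) ≤ m := m.cast_nonneg
    linarith
  exact ContinuousAt.comp (f := fun t : ℝ => A + I * t) h (by fun_prop)

lemma integrable_Gamma_vertical {A : ℂ} (hA : 0 < A.re) :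
    Integrable fun t : ℝ => Complex.Gamma (A + I * t) := by
  suffices h : Integrable fun t : ℝ => Complex.Gamma (A.re + I * t) by
    convert h.comp_add_right A.im using 2 with t
    congr 1
    apply Complex.ext <;> simp [add_comm]
  set σ := A.re with hσ
  have hb : ∀ t : ℝ, ‖Complex.Gamma (σ + I * t)‖ ≤
      (Real.Gamma (σ + 2) * (1 + (σ ^ 2)⁻¹)) * (1 + t ^ 2)⁻¹ := by
    intro t
    set z : ℂ := σ + I * t with hz
    have hre : z.re = σ := by simp [hz]
    have him : z.im = t := by simp [hz]
    have hz0 : z ≠ 0 := fun h => by rw [h] at hre; simp at hre; linarith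
    have hz1 : z + 1 ≠ 0 := fun h => by
      have := congrArg Complex.re h
      simp [hre] at this; linarith
    have e : Complex.Gamma (z + 2) = (z + 1) * (z * Complex.Gamma z) := by
      rw [← Complex.Gamma_add_one _ hz0, ← Complex.Gamma_add_one _ hz1]; ring_nf
    have h1 := norm_Gamma_le_Gamma_re (z := z + 2) (by simp [hre]; linarith)
    rw [e, norm_mul, norm_mul] at h1
    simp only [Complex.add_re, hre, Complex.re_ofNat] at h1
    have n1 : ‖z‖ ^ 2 = σ ^ 2 + t ^ 2 := by
      rw [← Complex.normSq_eq_norm_sq, Complex.normSq_apply, hre, him]; ring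
    have n2 : ‖z‖ ≤ ‖z + 1‖ := by
      refine (sq_le_sq₀ (norm_nonneg _) (norm_nonneg _)).1 ?_
      rw [n1, ← Complex.normSq_eq_norm_sq, Complex.normSq_apply]
      simp [hre, him]
      nlinarith
    have h2 : (σ ^ 2 + t ^ 2) * ‖Complex.Gamma z‖ ≤ Real.Gamma (σ + 2) := by
      rw [← n1]
      refine le_trans ?_ h1
      rw [sq, mul_assoc]
      gcongr
    have hG := norm_nonneg (Complex.Gamma z)
    have hσ2 : 0 < σ ^ 2 := by positivity
    rw [← div_eq_mul_inv, le_div_iff₀ (by positivity)]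
    have h3 : ‖Complex.Gamma z‖ * (1 + t ^ 2) ≤
        ((σ ^ 2 + t ^ 2) * ‖Complex.Gamma z‖) * (1 + (σ ^ 2)⁻¹) := by
      have : (σ ^ 2 + t ^ 2) * (1 + (σ ^ 2)⁻¹) = 1 + t ^ 2 + (σ ^ 2 + t ^ 2 * (σ ^ 2)⁻¹) := by
        field_simp; ring
      have h4 : 0 ≤ σ ^ 2 + t ^ 2 * (σ ^ 2)⁻¹ := by positivity
      calc _ ≤ ‖Complex.Gamma z‖ * ((σ ^ 2 + t ^ 2) * (1 + (σ ^ 2)⁻¹)) := by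
            rw [this]; exact mul_le_mul_of_nonneg_left (by linarith) hG
        _ = _ := by ring
    exact h3.trans (by gcongr)
  refine (integrable_inv_one_add_sq.const_mul _).mono'
    (continuous_Gamma_vertical (A := σ) (by simpa using hA)).aestronglyMeasurable
    (Filter.Eventually.of_forall hb)

lemma integral_cpow_mul_Gamma_vertical {A : ℂ} (hA : 0 < A.re) {x : ℝ} (hx : 0 < x) :
    ∫ t : ℝ, (x : ℂ) ^ (-(I * t)) * Complex.Gamma (A + I * t) =
      2 * π * ((x : ℂ) ^ A * Complex.exp (-x)) := by
  have hx' : (x : ℂ) ≠ 0 := by exact_mod_cast hx.ne'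
  set σ := A.re with hσ
  have hG : ∀ y : ℝ, mellin (fun x : ℝ => (Real.exp (-x) : ℂ)) (σ + y * I) =
      Complex.Gamma (σ + y * I) := by
    intro y
    rw [Complex.Gamma_eq_integral (by simpa using hA), Complex.GammaIntegral_eq_mellin]
  have hm := mellinInv_mellin_eq σ (fun x : ℝ => (Real.exp (-x) : ℂ)) hx
    (by
      have := Complex.GammaIntegral_convergent (s := σ) (by simpa using hA)
      refine this.congr (ae_of_all _ fun t => ?_)
      simp [mul_comm])
    (by
      have := integrable_Gamma_vertical (A := σ) (by simpa using hA)
      unfold Complex.VerticalIntegrable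
      simp_rw [hG]
      simpa [mul_comm] using this)
    (by fun_prop)
  unfold mellinInv at hm
  simp_rw [hG] at hm
  have h1 : ∫ t : ℝ, (x : ℂ) ^ (-(σ + t * I)) * Complex.Gamma (σ + t * I) =
      2 * π * Complex.exp (-x) := by
    have : (Real.exp (-x) : ℂ) = Complex.exp (-x) := by push_cast; rfl
    rw [← this, ← hm, Complex.real_smul]
    push_cast
    have : (π : ℂ) ≠ 0 := by exact_mod_cast Real.pi_ne_zero
    simp only [smul_eq_mul]
    rw [one_div, ← mul_assoc, mul_inv_cancel₀ (by simp), one_mul]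
  have h2 : ∀ t : ℝ, (x : ℂ) ^ (-(I * t)) * Complex.Gamma (A + I * t) = (x : ℂ) ^ A *
      ((x : ℂ) ^ (-(σ + ((t + A.im : ℝ) : ℂ) * I)) *
        Complex.Gamma (σ + ((t + A.im : ℝ) : ℂ) * I)) := by
    intro t
    have e : (σ : ℂ) + ((t + A.im : ℝ) : ℂ) * I = A + I * t := by
      apply Complex.ext <;> simp [hσ, add_comm]
    rw [e, ← mul_assoc, ← cpow_add _ _ hx']
    ring_nf
  simp_rw [h2]
  rw [integral_const_mul, integral_add_right_eq_self
    (fun t : ℝ => (x : ℂ) ^ (-(σ + (t : ℂ) * I)) * Complex.Gamma (σ + (t : ℂ) * I)), h1]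
  ring

lemma continuous_ofReal_cpow {α : Type*} [TopologicalSpace α] {f : α → ℝ} {g : α → ℂ}
    (hf : Continuous f) (hf0 : ∀ x, 0 < f x) (hg : Continuous g) :
    Continuous fun x => (f x : ℂ) ^ g x :=
  (Complex.continuous_ofReal.comp hf).cpow hg fun x => Complex.ofReal_mem_slitPlane.2 (hf0 x)

lemma cpow_mul_cpow_eq_div_cpow {x c : ℝ} (hx : 0 < x) (hc : 0 < c) (u : ℂ) (t : ℝ) :
    (x : ℂ) ^ (-(I * t)) * (c : ℂ) ^ (2 * (u + I * t / 2)) =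
      (c : ℂ) ^ (2 * u) * ((x / c : ℝ) : ℂ) ^ (-(I * t)) := by
  rw [cpow_def_of_ne_zero (by exact_mod_cast hx.ne'),
    cpow_def_of_ne_zero (by exact_mod_cast hc.ne'),
    cpow_def_of_ne_zero (by exact_mod_cast hc.ne'),
    cpow_def_of_ne_zero (by exact_mod_cast (div_pos hx hc).ne'), ← Complex.ofReal_log hx.le,
    ← Complex.ofReal_log hc.le, ← Complex.ofReal_log (div_pos hx hc).le,
    Real.log_div hx.ne' hc.ne', ← Complex.exp_add, ← Complex.exp_add]
  push_cast
  ring_nf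

lemma integral_Gamma_mul_Gamma_mul_cBeta {A B u v : ℂ} (hA : 0 < A.re) (hB : 0 < B.re)
    (hu : 0 < u.re) (hv : 0 < v.re) {x y : ℝ} (hx : 0 < x) (hy : 0 < y) :
    Integrable (fun a : ℝ => (expCos a : ℂ) ^ (2 * u) * (expCos (-a) : ℂ) ^ (2 * v) *
      (((x / expCos a : ℝ) : ℂ) ^ A * Complex.exp (-(x / expCos a : ℝ))) *
      (((y / expCos (-a) : ℝ) : ℂ) ^ B * Complex.exp (-(y / expCos (-a) : ℝ)))) ∧
    ∫ t : ℝ × ℝ, (x : ℂ) ^ (-(I * t.1)) * (y : ℂ) ^ (-(I * t.2)) * Complex.Gamma (A + I * t.1) *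
      Complex.Gamma (B + I * t.2) * cBeta (u + I * t.1 / 2) (v + I * t.2 / 2) =
    2 * (2 * π) ^ 2 * ∫ a : ℝ, (expCos a : ℂ) ^ (2 * u) * (expCos (-a) : ℂ) ^ (2 * v) *
      (((x / expCos a : ℝ) : ℂ) ^ A * Complex.exp (-(x / expCos a : ℝ))) *
      (((y / expCos (-a) : ℝ) : ℂ) ^ B * Complex.exp (-(y / expCos (-a) : ℝ))) := by
  have hxc : ∀ a, 0 < x / expCos a := fun a => div_pos hx (expCos_pos a)
  have hyc : ∀ a, 0 < y / expCos (-a) := fun a => div_pos hy (expCos_pos (-a))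
  have cc := continuous_expCos
  set F : ℝ × ℝ → ℝ → ℂ := fun t a =>
    (((x / expCos a : ℝ) : ℂ) ^ (-(I * t.1)) * ((y / expCos (-a) : ℝ) : ℂ) ^ (-(I * t.2))) *
    ((Complex.Gamma (A + I * t.1) * Complex.Gamma (B + I * t.2)) *
    ((expCos a : ℂ) ^ (2 * u) * (expCos (-a) : ℂ) ^ (2 * v))) with hF
  have hint : Integrable (Function.uncurry F) ((volume : Measure (ℝ × ℝ)).prod volume) := by
    have h0 := ((integrable_Gamma_vertical hA).mul_prod (integrable_Gamma_vertical hB)).mul_prod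
      (integrable_expCos_cpow hu hv)
    refine h0.bdd_mul (c := 1) (f := fun p : (ℝ × ℝ) × ℝ =>
      ((x / expCos p.2 : ℝ) : ℂ) ^ (-(I * p.1.1)) *
        ((y / expCos (-p.2) : ℝ) : ℂ) ^ (-(I * p.1.2))) ?_ (ae_of_all _ fun p => ?_)
    · refine Continuous.aestronglyMeasurable (Continuous.mul ?_ ?_)
      · refine continuous_ofReal_cpow (f := fun p : (ℝ × ℝ) × ℝ => x / expCos p.2) ?_
          (fun p => hxc p.2) (by fun_prop)
        exact continuous_const.div (by fun_prop) fun p => (expCos_pos _).ne'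
      · refine continuous_ofReal_cpow (f := fun p : (ℝ × ℝ) × ℝ => y / expCos (-p.2)) ?_
          (fun p => hyc p.2) (by fun_prop)
        exact continuous_const.div (by fun_prop) fun p => (expCos_pos _).ne'
    · rw [norm_mul, Complex.norm_cpow_eq_rpow_re_of_pos (hxc _),
        Complex.norm_cpow_eq_rpow_re_of_pos (hyc _)]
      simp
  have hF1 : ∀ t : ℝ × ℝ, (x : ℂ) ^ (-(I * t.1)) * (y : ℂ) ^ (-(I * t.2)) *
      Complex.Gamma (A + I * t.1) * Complex.Gamma (B + I * t.2) *
      cBeta (u + I * t.1 / 2) (v + I * t.2 / 2) = 2 * ∫ a, F t a := by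
    intro t
    rw [cBeta_eq_integral (by simpa using hu) (by simpa using hv), mul_left_comm,
      ← integral_const_mul]
    congr 2 with a
    have e1 := cpow_mul_cpow_eq_div_cpow hx (expCos_pos a) u t.1
    have e2 := cpow_mul_cpow_eq_div_cpow hy (expCos_pos (-a)) v t.2
    calc _ = ((x : ℂ) ^ (-(I * t.1)) * (expCos a : ℂ) ^ (2 * (u + I * t.1 / 2))) *
          ((y : ℂ) ^ (-(I * t.2)) * (expCos (-a) : ℂ) ^ (2 * (v + I * t.2 / 2))) *
          (Complex.Gamma (A + I * t.1) * Complex.Gamma (B + I * t.2)) := by ring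
      _ = _ := by rw [e1, e2, hF]; ring
  have hF2 : ∀ a, ∫ t, F t a = (2 * π) ^ 2 * ((expCos a : ℂ) ^ (2 * u) *
      (expCos (-a) : ℂ) ^ (2 * v) *
      (((x / expCos a : ℝ) : ℂ) ^ A * Complex.exp (-(x / expCos a : ℝ))) *
      (((y / expCos (-a) : ℝ) : ℂ) ^ B * Complex.exp (-(y / expCos (-a) : ℝ)))) := by
    intro a
    have h := integral_prod_mul (μ := (volume : Measure ℝ)) (ν := (volume : Measure ℝ))
      (fun t : ℝ => ((x / expCos a : ℝ) : ℂ) ^ (-(I * t)) * Complex.Gamma (A + I * t))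
      (fun t : ℝ => ((y / expCos (-a) : ℝ) : ℂ) ^ (-(I * t)) * Complex.Gamma (B + I * t))
    rw [integral_cpow_mul_Gamma_vertical hA (hxc a), integral_cpow_mul_Gamma_vertical hB (hyc a)]
      at h
    calc _ = ∫ t : ℝ × ℝ, ((((x / expCos a : ℝ) : ℂ) ^ (-(I * t.1)) * Complex.Gamma (A + I * t.1)) *
          (((y / expCos (-a) : ℝ) : ℂ) ^ (-(I * t.2)) * Complex.Gamma (B + I * t.2))) *
          ((expCos a : ℂ) ^ (2 * u) * (expCos (-a) : ℂ) ^ (2 * v)) := by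
          congr 1 with t; rw [hF]; ring
      _ = _ := by
        rw [integral_mul_const, Measure.volume_eq_prod, h]; ring
  refine ⟨?_, ?_⟩
  · have h := hint.integral_prod_right
    simp only [Function.uncurry_apply_pair, hF2] at h
    have hπ : ((2 * π : ℂ) ^ 2) ≠ 0 := by simp
    have h2 := h.const_mul ((2 * π : ℂ) ^ 2)⁻¹
    simpa only [inv_mul_cancel_left₀ hπ] using h2
  simp_rw [hF1]
  rw [integral_const_mul, integral_integral_swap hint]
  simp_rw [hF2]
  rw [integral_const_mul]
  ring

/-- The real kernel in the integral representation of the completed Whittaker function. -/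
noncomputable def whittakerKernel (d : ℕ) (x y : ℝ) (m' : ℤ) (a : ℝ) : ℝ :=
  expCos a ^ (((d : ℝ) + 1) / 2) * expCos (-a) ^ (-(((d : ℝ) - 1) / 2)) *
    ((1 + expCos (-a)) / expCos a) ^ m' * Real.exp (-(x / expCos a + y / expCos (-a)))

lemma one_add_expCos_div_zpow (m' : ℤ) (a : ℝ) :
    ((1 + expCos (-a)) / expCos a) ^ m' =
      (1 + (if 0 ≤ m' then 1 else -1) * expCos (-a)) ^ m'.natAbs * (expCos a ^ m'.natAbs)⁻¹ := by
  have hc := expCos_pos a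
  have hs := expCos_pos (-a)
  split_ifs with h
  · obtain ⟨n, rfl⟩ := Int.eq_ofNat_of_zero_le h
    simp [div_eq_mul_inv, mul_pow]
  · obtain ⟨n, hn⟩ := Int.eq_ofNat_of_zero_le (by lia : 0 ≤ -m')
    obtain rfl : m' = -(n : ℤ) := by lia
    rw [zpow_neg, ← inv_zpow, zpow_natCast, Int.natAbs_neg, Int.natAbs_natCast, ← div_eq_mul_inv,
      ← div_pow]
    congr 1
    rw [inv_div, div_eq_div_iff (by positivity) hc.ne']
    linear_combination expCos_sq_add_sq a

lemma sum_choose_mul_expCos_pow (m' : ℤ) (a : ℝ) :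
    ∑ ℓ ∈ Finset.range (m'.natAbs + 1), (if 0 ≤ m' then (1 : ℂ) else -1) ^ ℓ *
      (m'.natAbs.choose ℓ : ℂ) * (expCos (-a) : ℂ) ^ ℓ =
      (expCos a : ℂ) ^ m'.natAbs * (((1 + expCos (-a)) / expCos a) ^ m' : ℝ) := by
  have hc : (expCos a : ℂ) ≠ 0 := by exact_mod_cast (expCos_pos a).ne'
  have h := add_pow ((if 0 ≤ m' then (1 : ℂ) else -1) * expCos (-a)) 1 m'.natAbs
  rw [one_add_expCos_div_zpow]
  push_cast
  rw [mul_comm, mul_assoc, inv_mul_cancel₀ (pow_ne_zero _ hc), mul_one, add_comm (1 : ℂ)]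
  convert h.symm using 1
  · refine Finset.sum_congr rfl fun ℓ _ => ?_
    rw [mul_pow]; ring
  · congr 2; split_ifs <;> simp

lemma cpow_mul_div_cpow {x c : ℝ} (hx : 0 < x) (hc : 0 < c) (u A : ℂ) :
    (c : ℂ) ^ u * ((x / c : ℝ) : ℂ) ^ A = (x : ℂ) ^ A * (c : ℂ) ^ (u - A) := by
  rw [cpow_def_of_ne_zero (by exact_mod_cast hc.ne'),
    cpow_def_of_ne_zero (by exact_mod_cast (div_pos hx hc).ne'),
    cpow_def_of_ne_zero (by exact_mod_cast hx.ne'), cpow_def_of_ne_zero (by exact_mod_cast hc.ne'),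
    ← Complex.ofReal_log hx.le,
    ← Complex.ofReal_log hc.le, ← Complex.ofReal_log (div_pos hx hc).le,
    Real.log_div hx.ne' hc.ne', ← Complex.exp_add, ← Complex.exp_add]
  push_cast
  ring_nf

lemma expCos_cpow_mul_expCos_neg_cpow (z : ℂ) (a : ℝ) :
    (expCos a : ℂ) ^ z * (expCos (-a) : ℂ) ^ (-z) = Complex.exp (-(z * a)) := by
  have hc := expCos_pos a
  have hs := expCos_pos (-a)
  rw [cpow_def_of_ne_zero (by exact_mod_cast hc.ne'),
    cpow_def_of_ne_zero (by exact_mod_cast hs.ne'),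
    ← Complex.ofReal_log hc.le, ← Complex.ofReal_log hs.le, expCos_neg,
    Real.log_mul (Real.exp_pos _).ne' hc.ne', Real.log_exp, ← Complex.exp_add]
  push_cast
  ring_nf

lemma Wstar_eq_integral {d : ℕ} {r : ℂ} (hr : r.re = 0) {y₁ y₂ : ℝ} (hy₁ : 0 < y₁)
    (hy₂ : 0 < y₂) {m' : ℤ} (hm : m'.natAbs ≤ d) :
    Integrable (fun a : ℝ => Complex.exp (-(3 * r * a)) *
        (whittakerKernel d (2 * π * y₁) (2 * π * y₂) m' a : ℂ)) ∧
    Wstar d r y₁ y₂ m' = 2 * ((2 : ℂ) ^ (d + 1) * π)⁻¹ * √((2 * d).choose (d + m'.natAbs)) *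
      (((2 * π * y₁ : ℝ) : ℂ) ^ (((d : ℂ) + 1) / 2 - r) *
        ((2 * π * y₂ : ℝ) : ℂ) ^ (((d : ℂ) + 1) / 2 + r)) *
      ∫ a : ℝ, Complex.exp (-(3 * r * a)) *
        whittakerKernel d (2 * π * y₁) (2 * π * y₂) m' a := by
  set x := 2 * π * y₁ with hxdef
  set y := 2 * π * y₂ with hydef
  have hx : 0 < x := by positivity
  have hy : 0 < y := by positivity
  set m := m'.natAbs with hmdef
  set ε : ℂ := if 0 ≤ m' then (1 : ℂ) else -1 with hε
  set A : ℂ := ((d : ℂ) + 1) / 2 - r with hAdef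
  set B : ℂ := ((d : ℂ) + 1) / 2 + r with hBdef
  have hA : 0 < A.re := by simp [hAdef, hr]; positivity
  have hB : 0 < B.re := by simp [hBdef, hr]; positivity
  set u : ℂ := ((d : ℂ) - m + 1 + 2 * r) / 2 with hudef
  have hmd : (m : ℝ) ≤ d := by exact_mod_cast hm
  have hu : 0 < u.re := by simp [hudef, hr]; linarith
  set v : ℕ → ℂ := fun ℓ => ((ℓ : ℂ) + 1 - 2 * r) / 2 with hvdef
  have hv : ∀ ℓ, 0 < (v ℓ).re := fun ℓ => by simp [hvdef, hr]; positivity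
  set K : ℕ → ℝ → ℂ := fun ℓ a => (expCos a : ℂ) ^ (2 * u) * (expCos (-a) : ℂ) ^ (2 * v ℓ) *
      (((x / expCos a : ℝ) : ℂ) ^ A * Complex.exp (-(x / expCos a : ℝ))) *
      (((y / expCos (-a) : ℝ) : ℂ) ^ B * Complex.exp (-(y / expCos (-a) : ℝ))) with hK
  have hcore := fun ℓ => integral_Gamma_mul_Gamma_mul_cBeta hA hB hu (hv ℓ) hx hy
  have hint : ∀ ℓ : ℕ, ∫ t : ℝ × ℝ, (x : ℂ) ^ (1 - ((1 : ℂ) + I * t.1)) *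
      (y : ℂ) ^ (1 - ((1 : ℂ) + I * t.2)) *
      Complex.Gamma (((d : ℂ) - 1) / 2 + ((1 : ℂ) + I * t.1) - r) *
      Complex.Gamma (((d : ℂ) - 1) / 2 + ((1 : ℂ) + I * t.2) + r) *
      cBeta (((d : ℂ) - (m : ℂ) + ((1 : ℂ) + I * t.1) + 2 * r) / 2)
        (((ℓ : ℂ) + ((1 : ℂ) + I * t.2) - 2 * r) / 2) = 2 * (2 * π) ^ 2 * ∫ a, K ℓ a := by
    intro ℓ
    rw [← (hcore ℓ).2]
    congr 1 with t
    simp only [hAdef, hBdef, hudef, hvdef]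
    ring_nf
  have hsum : ∀ a : ℝ, ∑ ℓ ∈ Finset.range (m + 1), ε ^ ℓ * (m.choose ℓ : ℂ) * K ℓ a =
      (x : ℂ) ^ A * (y : ℂ) ^ B * (Complex.exp (-(3 * r * a)) * whittakerKernel d x y m' a) := by
    intro a
    have hc := expCos_pos a
    have hs := expCos_pos (-a)
    have hc' : (expCos a : ℂ) ≠ 0 := by exact_mod_cast hc.ne'
    have hs' : (expCos (-a) : ℂ) ≠ 0 := by exact_mod_cast hs.ne'
    have e1 : ∀ ℓ, ε ^ ℓ * (m.choose ℓ : ℂ) * K ℓ a = (ε ^ ℓ * (m.choose ℓ : ℂ) *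
        (expCos (-a) : ℂ) ^ ℓ) * ((x : ℂ) ^ A * (y : ℂ) ^ B * Complex.exp (-(3 * r * a)) *
        ((expCos a : ℂ) ^ (((d : ℂ) + 1) / 2) * (expCos (-a) : ℂ) ^ (-(((d : ℂ) - 1) / 2))) *
        ((expCos a : ℂ) ^ m)⁻¹ *
        (Complex.exp (-(x / expCos a : ℝ)) * Complex.exp (-(y / expCos (-a) : ℝ)))) := by
      intro ℓ
      have h1 := cpow_mul_div_cpow hx hc (2 * u) A
      have h2 := cpow_mul_div_cpow hy hs (2 * v ℓ) B
      have h3 : 2 * u - A = ((d : ℂ) + 1) / 2 - m + 3 * r := by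
        simp only [hAdef, hudef]; ring
      have h4 : 2 * v ℓ - B = ℓ + -(((d : ℂ) - 1) / 2) + -(3 * r) := by
        simp only [hBdef, hvdef]; ring
      rw [h3, cpow_add _ _ hc', cpow_sub _ _ hc', cpow_natCast] at h1
      rw [h4, cpow_add _ _ hs', cpow_add _ _ hs', cpow_natCast] at h2
      rw [← expCos_cpow_mul_expCos_neg_cpow]
      simp only [hK]
      linear_combination (ε ^ ℓ * (m.choose ℓ : ℂ) * Complex.exp (-(x / expCos a : ℝ)) *
        Complex.exp (-(y / expCos (-a) : ℝ))) * (((expCos (-a) : ℂ) ^ (2 * v ℓ) *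
        ((y / expCos (-a) : ℝ) : ℂ) ^ B) * h1 + ((x : ℂ) ^ A * ((expCos a : ℂ) ^ (((d : ℂ) + 1) / 2)
        / (expCos a : ℂ) ^ m * (expCos a : ℂ) ^ (3 * r))) * h2)
    simp_rw [e1]
    rw [← Finset.sum_mul, sum_choose_mul_expCos_pow, whittakerKernel, neg_add, Real.exp_add]
    push_cast
    rw [Complex.ofReal_cpow hc.le, Complex.ofReal_cpow hs.le]
    push_cast
    have : (expCos a : ℂ) ^ m ≠ 0 := pow_ne_zero _ hc'
    field_simp
    rw [← hmdef]
    ring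
  constructor
  · have hxy : (x : ℂ) ^ A * (y : ℂ) ^ B ≠ 0 := by
      simp [cpow_eq_zero_iff, hx.ne', hy.ne']
    rw [← integrable_const_mul_iff (isUnit_iff_ne_zero.2 hxy)]
    exact (integrable_finsetSum _ fun ℓ _ => (hcore ℓ).1.const_mul _).congr (ae_of_all _ hsum)
  unfold Wstar
  rw [← hxdef, ← hydef, ← hmdef, ← hε]
  rw [Finset.sum_congr rfl fun ℓ _ => congrArg _ (hint ℓ)]
  have hπ : (π : ℂ) ≠ 0 := by exact_mod_cast Real.pi_ne_zero
  have e2 : ∀ ℓ, ε ^ ℓ * (m.choose ℓ : ℂ) * (((2 * π : ℝ) : ℂ))⁻¹ ^ 2 *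
      (2 * (2 * π) ^ 2 * ∫ a, K ℓ a) = 2 * ∫ a, ε ^ ℓ * (m.choose ℓ : ℂ) * K ℓ a := by
    intro ℓ
    rw [integral_const_mul]
    push_cast
    field_simp
  rw [Finset.sum_congr rfl fun ℓ _ => e2 ℓ]
  rw [← Finset.mul_sum, ← integral_finsetSum _ fun ℓ _ => (hcore ℓ).1.const_mul _]
  rw [integral_congr_ae (ae_of_all _ hsum)]
  rw [integral_const_mul]
  ring

lemma integrableOn_rpow_mul_exp_neg {s b : ℝ} (hs : 0 < s) (hb : 0 < b) :
    IntegrableOn (fun y : ℝ => y ^ (s - 1) * Real.exp (-(b * y))) (Set.Ioi 0) :=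
  Integrable.of_integral_ne_zero (by
    rw [Real.integral_rpow_mul_exp_neg_mul_Ioi hs hb]
    positivity)

lemma integral_Ioi_Ioi_integral_gammaKernel {α : Type*} [MeasurableSpace α] {ν : Measure α}
    [SFinite ν] {s₁ s₂ : ℝ} (hs₁ : 0 < s₁) (hs₂ : 0 < s₂) {w : α → ℂ} {b₁ b₂ : α → ℝ}
    (hw : Measurable w) (hb₁ : Measurable b₁) (hb₂ : Measurable b₂) (hb₁0 : ∀ p, 0 < b₁ p)
    (hb₂0 : ∀ p, 0 < b₂ p)
    (h : Integrable (fun p => w p * ((b₁ p ^ (-s₁) * b₂ p ^ (-s₂) : ℝ) : ℂ)) ν) :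
    ∫ y₁ in Set.Ioi (0 : ℝ), ∫ y₂ in Set.Ioi (0 : ℝ), ∫ p, w p *
      (((y₁ ^ (s₁ - 1) * Real.exp (-(b₁ p * y₁))) *
        (y₂ ^ (s₂ - 1) * Real.exp (-(b₂ p * y₂))) : ℝ) : ℂ) ∂ν =
    ((Real.Gamma s₁ * Real.Gamma s₂ : ℝ) : ℂ) *
      ∫ p, w p * ((b₁ p ^ (-s₁) * b₂ p ^ (-s₂) : ℝ) : ℂ) ∂ν := by
  set μ : Measure (ℝ × ℝ) := (volume.restrict (Set.Ioi 0)).prod (volume.restrict (Set.Ioi 0))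
    with hμ
  set g : α → ℝ × ℝ → ℝ := fun p y => (y.1 ^ (s₁ - 1) * Real.exp (-(b₁ p * y.1))) *
        (y.2 ^ (s₂ - 1) * Real.exp (-(b₂ p * y.2))) with hg
  have hgi : ∀ p, Integrable (g p) μ := fun p =>
    (integrableOn_rpow_mul_exp_neg hs₁ (hb₁0 p)).mul_prod
      (integrableOn_rpow_mul_exp_neg hs₂ (hb₂0 p))
  have hgI : ∀ p, ∫ y, g p y ∂μ = Real.Gamma s₁ * Real.Gamma s₂ *
      (b₁ p ^ (-s₁) * b₂ p ^ (-s₂)) := by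
    intro p
    rw [hg, hμ, integral_prod_mul (fun y : ℝ => y ^ (s₁ - 1) * Real.exp (-(b₁ p * y)))
      (fun y : ℝ => y ^ (s₂ - 1) * Real.exp (-(b₂ p * y))),
      Real.integral_rpow_mul_exp_neg_mul_Ioi hs₁ (hb₁0 p),
      Real.integral_rpow_mul_exp_neg_mul_Ioi hs₂ (hb₂0 p), one_div, one_div,
      Real.inv_rpow (hb₁0 p).le, Real.inv_rpow (hb₂0 p).le, Real.rpow_neg (hb₁0 p).le,
      Real.rpow_neg (hb₂0 p).le]
    ring
  have hpos : ∀ᵐ y ∂μ, 0 < y.1 ∧ 0 < y.2 := by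
    rw [hμ, Measure.prod_restrict]
    exact ae_restrict_of_forall_mem (measurableSet_Ioi.prod measurableSet_Ioi) fun y hy => hy
  have hgn : ∀ p, ∀ᵐ y ∂μ, ‖w p * (g p y : ℂ)‖ = ‖w p‖ * g p y := by
    intro p
    filter_upwards [hpos] with y hy
    have h0 : 0 ≤ g p y := by
      have := hy.1
      have := hy.2
      positivity
    rw [norm_mul, Complex.norm_real, Real.norm_of_nonneg h0]
  have hint : Integrable (fun q : (ℝ × ℝ) × α => w q.2 * (g q.2 q.1 : ℂ)) (μ.prod ν) := by
    refine (integrable_prod_iff' ?_).2 ⟨ae_of_all _ fun p => ?_, ?_⟩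
    · refine Measurable.aestronglyMeasurable ?_
      simp only [hg]
      fun_prop
    · exact (hgi p).ofReal.const_mul (w p)
    · have : ∀ p, ∫ y, ‖w p * (g p y : ℂ)‖ ∂μ =
          (Real.Gamma s₁ * Real.Gamma s₂) * ‖w p * ((b₁ p ^ (-s₁) * b₂ p ^ (-s₂) : ℝ) : ℂ)‖ := by
        intro p
        have := hb₁0 p
        have := hb₂0 p
        rw [integral_congr_ae (hgn p), integral_const_mul, hgI, norm_mul, Complex.norm_real,
          Real.norm_of_nonneg (by positivity)]
        ring
      simp_rw [this]
      exact h.norm.const_mul _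
  have hy := integral_prod _ hint.integral_prod_left
  refine hy.symm.trans ?_
  rw [integral_integral_swap hint, ← integral_const_mul]
  refine integral_congr_ae (ae_of_all _ fun p => ?_)
  simp only
  rw [integral_const_mul, integral_complex_ofReal, hgI]
  push_cast
  ring

lemma sum_choose_mul_zpow (d : ℕ) {z : ℝ} (hz : z ≠ 0) :
    ∑ m' ∈ Finset.Icc (-(d : ℤ)) (d : ℤ), ((2 * d).choose (d + m'.natAbs) : ℝ) * z ^ m' =
      (z + 2 + z⁻¹) ^ d := by
  have h1 : (z + 2 + z⁻¹) ^ d = (1 + z) ^ (2 * d) * (z ^ d)⁻¹ := by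
    rw [pow_mul, ← div_eq_mul_inv, ← div_pow]
    congr 1
    field_simp
    ring
  rw [h1, add_comm, add_pow, Finset.sum_mul]
  symm
  refine Finset.sum_bij' (fun k _ => (k : ℤ) - d) (fun m' _ => (m' + d).toNat) ?_ ?_ ?_ ?_ ?_
  · intro k hk; simp at hk ⊢; lia
  · intro k hk; simp at hk ⊢; lia
  · intro k hk; simp
  · intro k hk; simp at hk ⊢; lia
  · intro k hk
    have hk' : k ≤ 2 * d := by simpa [Nat.lt_succ_iff] using hk
    have hc : (2 * d).choose (d + ((k : ℤ) - d).natAbs) = (2 * d).choose k := by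
      rcases le_total d k with h | h
      · congr 1; lia
      · rw [← Nat.choose_symm hk']; congr 1; lia
    rw [hc, zpow_sub₀ hz, zpow_natCast, zpow_natCast, one_pow, div_eq_mul_inv]
    ring

lemma tendsto_expCos_atTop : Filter.Tendsto expCos Filter.atTop (nhds 0) :=
  squeeze_zero (fun a => (expCos_pos a).le) expCos_le_exp_neg
    (Real.tendsto_exp_atBot.comp Filter.tendsto_neg_atTop_atBot)

/-- The sum of the reciprocals of `expCos a` and `expCos b`. -/
noncomputable def recipSum (a b : ℝ) : ℝ := (expCos a)⁻¹ + (expCos b)⁻¹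

lemma recipSum_pos (a b : ℝ) : 0 < recipSum a b :=
  add_pos (inv_pos.2 (expCos_pos a)) (inv_pos.2 (expCos_pos b))

lemma continuous_recipSum : Continuous fun p : ℝ × ℝ => recipSum p.1 p.2 := by
  have := continuous_expCos
  unfold recipSum
  exact ((this.comp continuous_fst).inv₀ fun p => (expCos_pos _).ne').add
    ((this.comp continuous_snd).inv₀ fun p => (expCos_pos _).ne')

lemma one_le_recipSum (a b : ℝ) : 1 ≤ recipSum a b := by
  have := one_le_inv_iff₀.2 ⟨expCos_pos a, expCos_le_one a⟩
  have := inv_pos.2 (expCos_pos b)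
  unfold recipSum; linarith

lemma exp_le_recipSum (a b : ℝ) : Real.exp a ≤ recipSum a b := by
  have h : Real.exp a ≤ (expCos a)⁻¹ := by
    rw [le_inv_comm₀ (Real.exp_pos _) (expCos_pos _), ← Real.exp_neg]
    exact expCos_le_exp_neg a
  have := inv_pos.2 (expCos_pos b)
  unfold recipSum; linarith

lemma tendsto_recipSum_atBot (x : ℝ) :
    Filter.Tendsto (fun a => recipSum a (a + x)) Filter.atBot (nhds 2) := by
  have h1 := tendsto_expCos_atBot.inv₀ one_ne_zero
  have h2 := (tendsto_expCos_atBot.comp (Filter.tendsto_atBot_add_const_right _ x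
    Filter.tendsto_id)).inv₀ one_ne_zero
  have h := h1.add h2
  norm_num at h
  exact h

lemma recipSum_neg_eq (a x : ℝ) :
    recipSum (-a) (-(a + x)) * Real.exp a = (expCos a)⁻¹ + Real.exp (-x) * (expCos (a + x))⁻¹ := by
  unfold recipSum
  rw [expCos_neg, expCos_neg, Real.exp_add, Real.exp_neg]
  have := expCos_pos a
  have := expCos_pos (a + x)
  have := Real.exp_pos a
  field_simp

lemma tendsto_recipSum_neg_atBot (x : ℝ) :
    Filter.Tendsto (fun a => recipSum (-a) (-(a + x)) * Real.exp a) Filter.atBot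
      (nhds (1 + Real.exp (-x))) := by
  simp_rw [recipSum_neg_eq]
  have h1 := tendsto_expCos_atBot.inv₀ one_ne_zero
  have h2 := (tendsto_expCos_atBot.comp (Filter.tendsto_atBot_add_const_right _ x
    Filter.tendsto_id)).inv₀ one_ne_zero
  have h := h1.add (h2.const_mul (Real.exp (-x)))
  simp only [inv_one, mul_one] at h
  exact h

/-- The factor of the local zeta kernel that is raised to the power `d - 1`. -/
noncomputable def balance (a b : ℝ) : ℝ :=
  (√(expCos a * expCos b * (expCos (-a) * expCos (-b))) * recipSum a b *
    recipSum (-a) (-b))⁻¹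

/-- The factor of the local zeta kernel that is raised to the power `t`. -/
noncomputable def height (a b : ℝ) : ℝ := (recipSum a b ^ 2 * recipSum (-a) (-b))⁻¹

/-- The factor of the local zeta kernel that is raised to the power `d`. -/
noncomputable def angleFactor (a b : ℝ) : ℝ :=
  2 * (1 + expCos a * expCos b + expCos (-a) * expCos (-b))

/-- The kernel whose integral is the local zeta integral, up to elementary factors. -/
noncomputable def zetaKernel (d : ℕ) (t a b : ℝ) : ℝ :=
  angleFactor a b ^ d * balance a b ^ (d - 1) * height a b ^ t

lemma balance_neg (a b : ℝ) : balance (-a) (-b) = balance a b := by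
  unfold balance
  rw [neg_neg, neg_neg, mul_comm (expCos (-a) * expCos (-b)), mul_right_comm]

lemma angleFactor_neg (a b : ℝ) : angleFactor (-a) (-b) = angleFactor a b := by
  unfold angleFactor
  rw [neg_neg, neg_neg]; ring

lemma balance_pos (a b : ℝ) : 0 < balance a b := by
  have := expCos_pos a
  have := expCos_pos b
  have := expCos_pos (-a)
  have := expCos_pos (-b)
  have := recipSum_pos a b
  have := recipSum_pos (-a) (-b)
  unfold balance; positivity

lemma height_pos (a b : ℝ) : 0 < height a b := by
  have := recipSum_pos a b
  have := recipSum_pos (-a) (-b)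
  unfold height; positivity

lemma angleFactor_pos (a b : ℝ) : 0 < angleFactor a b := by
  have := expCos_pos a
  have := expCos_pos b
  have := expCos_pos (-a)
  have := expCos_pos (-b)
  unfold angleFactor; positivity

lemma angleFactor_le (a b : ℝ) : angleFactor a b ≤ 6 := by
  have h1 := mul_le_one₀ (expCos_le_one a) (expCos_pos b).le (expCos_le_one b)
  have h2 := mul_le_one₀ (expCos_le_one (-a)) (expCos_pos (-b)).le (expCos_le_one (-b))
  unfold angleFactor; linarith

lemma continuous_balance : Continuous fun p : ℝ × ℝ => balance p.1 p.2 := by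
  have h1 := continuous_expCos
  have h2 := continuous_recipSum
  have h3 : Continuous fun p : ℝ × ℝ => recipSum (-p.1) (-p.2) := h2.comp continuous_neg
  unfold balance
  refine Continuous.inv₀ (by fun_prop) fun p => ?_
  have := balance_pos p.1 p.2
  unfold balance at this
  exact (inv_pos.1 this).ne'

lemma continuous_height : Continuous fun p : ℝ × ℝ => height p.1 p.2 := by
  have h2 := continuous_recipSum
  have h3 : Continuous fun p : ℝ × ℝ => recipSum (-p.1) (-p.2) := h2.comp continuous_neg
  unfold height
  refine Continuous.inv₀ (by fun_prop) fun p => ?_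
  exact (inv_pos.1 (height_pos p.1 p.2)).ne'

lemma continuous_zetaKernel (d : ℕ) (t : ℝ) :
    Continuous fun p : ℝ × ℝ => zetaKernel d t p.1 p.2 := by
  have h1 := continuous_expCos
  have h2 := continuous_balance
  have h3 := continuous_height
  unfold zetaKernel angleFactor
  refine Continuous.mul (by fun_prop) (h3.rpow_const fun p => Or.inl (height_pos _ _).ne')

lemma zetaKernel_pos (d : ℕ) (t a b : ℝ) : 0 < zetaKernel d t a b := by
  have := angleFactor_pos a b
  have := balance_pos a b
  have := height_pos a b
  unfold zetaKernel; positivity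

lemma balance_add_eq (a x : ℝ) : balance a (a + x) =
    ((expCos (a + x) / expCos a) * Real.exp (x / 2) + Real.exp (-(x / 2)) + Real.exp (x / 2) +
      (expCos a / expCos (a + x)) * Real.exp (-(x / 2)))⁻¹ := by
  unfold balance recipSum
  have h1 := expCos_pos a
  have h2 := expCos_pos (a + x)
  have h4 := Real.exp_pos (x / 2)
  have h3 := Real.exp_pos a
  have e : expCos a * expCos (a + x) * (expCos (-a) * expCos (-(a + x))) =
      (expCos a * expCos (a + x) * Real.exp a * Real.exp (x / 2)) ^ 2 := by
    have : Real.exp (a + x) = Real.exp a * Real.exp (x / 2) ^ 2 := by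
      rw [← Real.exp_nat_mul, ← Real.exp_add]; congr 1; push_cast; ring
    rw [expCos_neg, expCos_neg, this]; ring
  have e2 : Real.exp (a + x) = Real.exp a * Real.exp (x / 2) ^ 2 := by
    rw [← Real.exp_nat_mul, ← Real.exp_add]; congr 1; push_cast; ring
  rw [e, Real.sqrt_sq (by positivity), expCos_neg, expCos_neg, e2, Real.exp_neg (x / 2)]
  congr 1
  field_simp
  ring

lemma expCos_half_mul (x : ℝ) :
    expCos (x / 2) * expCos (-(x / 2)) = (Real.exp (x / 2) + Real.exp (-(x / 2)))⁻¹ := by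
  have h := Real.exp_pos (x / 2)
  rw [expCos_neg, mul_left_comm, ← sq, expCos_sq, Real.exp_neg, two_mul, Real.exp_add]
  field_simp
  ring

lemma balance_add_le (a x : ℝ) :
    balance a (a + x) ≤ expCos (x / 2) * expCos (-(x / 2)) := by
  rw [expCos_half_mul, balance_add_eq]
  have h1 := expCos_pos a
  have h2 := expCos_pos (a + x)
  have h3 : 0 < expCos (a + x) / expCos a * Real.exp (x / 2) := by positivity
  have h4 : 0 < expCos a / expCos (a + x) * Real.exp (-(x / 2)) := by positivity
  exact inv_anti₀ (by positivity) (by linarith)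

lemma height_rpow_le {t : ℝ} (ht : 0 < t) (v b : ℝ) :
    height (v / -t) b ^ t ≤ Real.exp (-|v|) := by
  have hα := one_le_recipSum (v / -t) b
  have hβ := one_le_recipSum (-(v / -t)) (-b)
  have hα' := exp_le_recipSum (v / -t) b
  have hβ' := exp_le_recipSum (-(v / -t)) (-b)
  have key : ∀ c : ℝ, Real.exp c ≤ recipSum (v / -t) b ^ 2 * recipSum (-(v / -t)) (-b) →
      height (v / -t) b ^ t ≤ Real.exp (-(c * t)) := by
    intro c hc
    have h : height (v / -t) b ≤ Real.exp (-c) := by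
      rw [height, Real.exp_neg]
      exact inv_anti₀ (Real.exp_pos _) hc
    calc _ ≤ Real.exp (-c) ^ t := Real.rpow_le_rpow (height_pos _ _).le h ht.le
      _ = _ := by rw [← Real.exp_mul]; ring_nf
  rcases le_total 0 v with hv | hv
  · refine (key (v / t) ?_).trans_eq ?_
    · rw [div_neg, neg_neg] at hβ'
      rw [div_neg, neg_neg] at hβ ⊢
      rw [div_neg] at hα
      nlinarith [one_le_pow₀ hα (n := 2)]
    · rw [abs_of_nonneg hv, div_mul_cancel₀ _ ht.ne']
  · refine (key (v / -t) ?_).trans_eq ?_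
    · nlinarith [Real.exp_pos (v / -t), sq_nonneg (recipSum (v / -t) b - 1)]
    · rw [abs_of_nonpos hv, div_neg, neg_mul, div_mul_cancel₀ _ ht.ne']

lemma zetaKernel_le (d : ℕ) {t : ℝ} (ht : 0 < t) (v x : ℝ) :
    zetaKernel d t (v / -t) (v / -t + x) ≤
      Real.exp (-|v|) * (6 ^ d * (expCos (x / 2) * expCos (-(x / 2))) ^ (d - 1)) := by
  rw [mul_comm]
  unfold zetaKernel
  have h1 := angleFactor_pos (v / -t) (v / -t + x)
  have h2 := balance_pos (v / -t) (v / -t + x)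
  have h3 := height_pos (v / -t) (v / -t + x)
  have h4 := mul_pos (expCos_pos (x / 2)) (expCos_pos (-(x / 2)))
  gcongr
  · exact angleFactor_le _ _
  · exact balance_add_le _ _
  · exact height_rpow_le ht _ _

lemma tendsto_balance_atBot (x : ℝ) :
    Filter.Tendsto (fun a => balance a (a + x)) Filter.atBot
      (nhds (expCos (x / 2) * expCos (-(x / 2)) / 2)) := by
  simp_rw [balance_add_eq]
  have h1 := tendsto_expCos_atBot
  have h2 : Filter.Tendsto (fun a => expCos (a + x)) Filter.atBot (nhds 1) :=
    h1.comp (Filter.tendsto_atBot_add_const_right _ x Filter.tendsto_id)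
  have h3 := ((((h2.div h1 one_ne_zero).mul_const (Real.exp (x / 2))).add_const
    (Real.exp (-(x / 2)))).add_const (Real.exp (x / 2))).add
    ((h1.div h2 one_ne_zero).mul_const (Real.exp (-(x / 2))))
  have h4 := h3.inv₀ (by positivity)
  have e : expCos (x / 2) * expCos (-(x / 2)) / 2 = (1 / 1 * Real.exp (x / 2) +
      Real.exp (-(x / 2)) + Real.exp (x / 2) + 1 / 1 * Real.exp (-(x / 2)))⁻¹ := by
    rw [expCos_half_mul, div_eq_mul_inv, ← mul_inv]
    congr 1
    ring
  rw [e]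
  exact h4

lemma tendsto_balance_atTop (x : ℝ) :
    Filter.Tendsto (fun a => balance a (a + x)) Filter.atTop
      (nhds (expCos (x / 2) * expCos (-(x / 2)) / 2)) := by
  have h := (tendsto_balance_atBot (-x)).comp Filter.tendsto_neg_atTop_atBot
  rw [neg_div, neg_neg, mul_comm] at h
  refine h.congr fun a => ?_
  rw [Function.comp_apply, ← balance_neg, neg_neg]
  congr 1; ring

lemma tendsto_angleFactor_atBot (x : ℝ) :
    Filter.Tendsto (fun a => angleFactor a (a + x)) Filter.atBot (nhds 4) := by
  have h1 := tendsto_expCos_atBot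
  have ha : Filter.Tendsto (fun a : ℝ => a + x) Filter.atBot Filter.atBot :=
    Filter.tendsto_atBot_add_const_right _ x Filter.tendsto_id
  have h2 : Filter.Tendsto (fun a => expCos (a + x)) Filter.atBot (nhds 1) := h1.comp ha
  have h3 : Filter.Tendsto (fun a => expCos (-a)) Filter.atBot (nhds 0) :=
    tendsto_expCos_atTop.comp Filter.tendsto_neg_atBot_atTop
  have h4 : Filter.Tendsto (fun a => expCos (-(a + x))) Filter.atBot (nhds 0) := h3.comp ha
  have h := ((((h1.mul h2).const_add 1).add (h3.mul h4)).const_mul 2)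
  have e : (2 : ℝ) * (1 + 1 * 1 + 0 * 0) = 4 := by norm_num
  rw [e] at h
  exact h

lemma tendsto_angleFactor_atTop (x : ℝ) :
    Filter.Tendsto (fun a => angleFactor a (a + x)) Filter.atTop (nhds 4) := by
  have h := (tendsto_angleFactor_atBot (-x)).comp Filter.tendsto_neg_atTop_atBot
  refine h.congr fun a => ?_
  rw [Function.comp_apply, ← angleFactor_neg, neg_neg]
  congr 1; ring

lemma tendsto_height_mul_atBot (x : ℝ) :
    Filter.Tendsto (fun a => height a (a + x) * Real.exp (-a)) Filter.atBot
      (nhds (2 ^ 2 * (1 + Real.exp (-x)))⁻¹) := by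
  have h := (((tendsto_recipSum_atBot x).pow 2).mul (tendsto_recipSum_neg_atBot x)).inv₀
    (by positivity)
  refine h.congr fun a => ?_
  rw [height, Real.exp_neg, ← mul_inv]
  ring_nf

lemma tendsto_height_mul_atTop (x : ℝ) :
    Filter.Tendsto (fun a => height a (a + x) * Real.exp (2 * a)) Filter.atTop
      (nhds ((1 + Real.exp x) ^ 2 * 2)⁻¹) := by
  have h1 := (tendsto_recipSum_atBot (-x)).comp Filter.tendsto_neg_atTop_atBot
  have h2 := (tendsto_recipSum_neg_atBot (-x)).comp Filter.tendsto_neg_atTop_atBot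
  rw [neg_neg] at h2
  have h := ((h2.pow 2).mul h1).inv₀ (by positivity)
  refine h.congr fun a => ?_
  have e1 : -a + -x = -(a + x) := by ring
  simp only [Function.comp_apply]
  rw [e1, neg_neg, neg_neg, height, mul_inv, mul_inv, mul_pow, mul_inv, ← Real.exp_nat_mul,
    ← Real.exp_neg]
  push_cast
  ring_nf

/-- The limit of the rescaled power of the height. -/
noncomputable def heightLimit (v : ℝ) : ℝ := if 0 < v then Real.exp (-v) else Real.exp (2 * v)

lemma tendsto_rpow_of_tendsto_mul_exp {f g : ℝ → ℝ} {c v p : ℝ} (hp : 0 < p)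
    (hf : ∀ t, 0 < f t)
    (h : Filter.Tendsto (fun t => f t * Real.exp (c * g t)) (nhdsWithin 0 (Set.Ioi 0)) (nhds p))
    (hg : ∀ t, 0 < t → g t * t = v) :
    Filter.Tendsto (fun t => f t ^ t) (nhdsWithin 0 (Set.Ioi 0)) (nhds (Real.exp (-(c * v)))) := by
  have h0 : Filter.Tendsto (fun t : ℝ => t) (nhdsWithin 0 (Set.Ioi 0)) (nhds 0) :=
    Filter.tendsto_id.mono_left nhdsWithin_le_nhds
  have h1 := (h.rpow h0 (Or.inl hp.ne')).mul_const (Real.exp (-(c * v)))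
  rw [Real.rpow_zero, one_mul] at h1
  refine h1.congr' ?_
  filter_upwards [self_mem_nhdsWithin] with t ht
  rw [Real.mul_rpow (hf t).le (Real.exp_pos _).le, ← Real.exp_mul, mul_assoc c, hg t ht, mul_assoc,
    ← Real.exp_add, add_neg_cancel, Real.exp_zero, mul_one]

lemma tendsto_zetaKernel {d : ℕ} (x : ℝ) {v : ℝ} (hv : v ≠ 0) :
    Filter.Tendsto (fun t => zetaKernel d t (v / -t) (v / -t + x)) (nhdsWithin 0 (Set.Ioi 0))
      (nhds (heightLimit v * (4 ^ d * (expCos (x / 2) * expCos (-(x / 2)) / 2) ^ (d - 1)))) := by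
  rw [mul_comm]
  have hinv : Filter.Tendsto (fun t : ℝ => (-t)⁻¹) (nhdsWithin 0 (Set.Ioi 0)) Filter.atBot := by
    simp_rw [inv_neg]
    exact Filter.tendsto_neg_atTop_atBot.comp tendsto_inv_nhdsGT_zero
  unfold zetaKernel
  rcases lt_or_gt_of_ne hv with h | h
  · have hl : Filter.Tendsto (fun t : ℝ => v / -t) (nhdsWithin 0 (Set.Ioi 0)) Filter.atTop :=
      hinv.const_mul_atBot_of_neg h
    refine ((((tendsto_angleFactor_atTop x).comp hl).pow d).mul
      (((tendsto_balance_atTop x).comp hl).pow (d - 1))).mul ?_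
    rw [heightLimit, if_neg (not_lt.2 h.le)]
    have := tendsto_rpow_of_tendsto_mul_exp (v := -v) (f := fun t => height (v / -t) (v / -t + x))
      (by positivity) (fun t => height_pos _ _) ((tendsto_height_mul_atTop x).comp hl)
      (fun t ht => by field_simp)
    simpa using this
  · have hl : Filter.Tendsto (fun t : ℝ => v / -t) (nhdsWithin 0 (Set.Ioi 0)) Filter.atBot :=
      hinv.const_mul_atBot h
    refine ((((tendsto_angleFactor_atBot x).comp hl).pow d).mul
      (((tendsto_balance_atBot x).comp hl).pow (d - 1))).mul ?_
    rw [heightLimit, if_pos h]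
    have h2 := (tendsto_height_mul_atBot x).comp hl
    have := tendsto_rpow_of_tendsto_mul_exp (c := -1) (v := -v)
      (f := fun t => height (v / -t) (v / -t + x)) (g := fun t => v / -t)
      (by positivity) (fun t => height_pos _ _) (h2.congr fun t => by simp)
      (fun t ht => by field_simp)
    simpa using this

lemma integrable_exp_neg_abs : Integrable fun v : ℝ => Real.exp (-|v|) := by
  rw [← integrableOn_univ, ← Set.Iic_union_Ioi (a := (0 : ℝ)), integrableOn_union]
  constructor
  · refine (integrableOn_exp_Iic 0).congr_fun (fun v hv => ?_) measurableSet_Iic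
    rw [abs_of_nonpos hv, neg_neg]
  · refine (integrableOn_exp_neg_Ioi 0).congr_fun (fun v hv => ?_) measurableSet_Ioi
    rw [abs_of_pos hv]

lemma integral_heightLimit : ∫ v, heightLimit v = 3 / 2 := by
  have h1 : Set.EqOn heightLimit (fun v => Real.exp (2 * v)) (Set.Iic 0) := fun v hv => by
    rw [heightLimit, if_neg (not_lt.2 hv)]
  have h2 : Set.EqOn heightLimit (fun v => Real.exp (-v)) (Set.Ioi 0) := fun v hv => by
    exact if_pos hv
  rw [← intervalIntegral.integral_Iic_add_Ioi (b := 0)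
    ((integrableOn_exp_mul_Iic two_pos 0).congr_fun h1.symm measurableSet_Iic)
    ((integrableOn_exp_neg_Ioi 0).congr_fun h2.symm measurableSet_Ioi),
    setIntegral_congr_fun measurableSet_Iic h1, setIntegral_congr_fun measurableSet_Ioi h2,
    integral_exp_mul_Iic two_pos, integral_exp_neg_Ioi_zero]
  norm_num

lemma expCos_mul_cpow_eq {d : ℕ} (hd : 1 ≤ d) (r : ℂ) (a : ℝ) :
    (expCos a : ℂ) ^ (2 * (((d : ℂ) - 1) / 2 - 3 * r)) *
      (expCos (-a) : ℂ) ^ (2 * (((d : ℂ) - 1) / 2 + 3 * r)) =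
    Complex.exp (3 * r * (2 * a : ℝ)) * ((expCos a * expCos (-a)) ^ (d - 1) : ℝ) := by
  have hc : (expCos a : ℂ) ≠ 0 := by exact_mod_cast (expCos_pos a).ne'
  have hs : (expCos (-a) : ℂ) ≠ 0 := by exact_mod_cast (expCos_pos (-a)).ne'
  have e1 : 2 * (((d : ℂ) - 1) / 2 - 3 * r) = ((d - 1 : ℕ) : ℂ) + -(6 * r) := by
    push_cast [hd]; ring
  have e2 : 2 * (((d : ℂ) - 1) / 2 + 3 * r) = ((d - 1 : ℕ) : ℂ) + -(-(6 * r)) := by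
    push_cast [hd]; ring
  have h := expCos_cpow_mul_expCos_neg_cpow (-(6 * r)) a
  have e3 : -(-(6 * r) * (a : ℂ)) = 3 * r * (2 * a : ℝ) := by push_cast; ring
  rw [e1, e2, cpow_add _ _ hc, cpow_add _ _ hs, cpow_natCast, cpow_natCast, ← e3, ← h]
  push_cast
  ring

lemma integrable_exp_mul_expCos_pow {d : ℕ} (hd : 2 ≤ d) {r : ℂ} (hr : r.re = 0) :
    Integrable fun x : ℝ => Complex.exp (3 * r * x) *
      ((expCos (x / 2) * expCos (-(x / 2))) ^ (d - 1) : ℝ) := by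
  have hd' : (2 : ℝ) ≤ d := by exact_mod_cast hd
  have h := integrable_expCos_cpow (u := ((d : ℂ) - 1) / 2 - 3 * r)
    (v := ((d : ℂ) - 1) / 2 + 3 * r) (by simp [hr]; linarith) (by simp [hr]; linarith)
  simp_rw [expCos_mul_cpow_eq (by lia : 1 ≤ d)] at h
  refine (h.comp_div two_ne_zero).congr (ae_of_all _ fun x => ?_)
  simp only
  rw [mul_div_cancel₀ _ (two_ne_zero' ℝ)]

lemma integral_exp_mul_expCos_pow {d : ℕ} (hd : 2 ≤ d) {r : ℂ} (hr : r.re = 0) :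
    ∫ x : ℝ, Complex.exp (3 * r * x) *
      ((expCos (x / 2) * expCos (-(x / 2))) ^ (d - 1) : ℝ) =
    cBeta (((d : ℂ) - 1) / 2 - 3 * r) (((d : ℂ) - 1) / 2 + 3 * r) := by
  have hd' : (2 : ℝ) ≤ d := by exact_mod_cast hd
  rw [cBeta_eq_integral (by simp [hr]; linarith) (by simp [hr]; linarith)]
  simp_rw [expCos_mul_cpow_eq (by lia : 1 ≤ d)]
  have h := Measure.integral_comp_div (fun a : ℝ => Complex.exp (3 * r * (2 * a : ℝ)) *
    ((expCos a * expCos (-a)) ^ (d - 1) : ℝ)) 2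
  simp_rw [mul_div_cancel₀ _ (two_ne_zero' ℝ)] at h
  rw [h]
  simp

lemma norm_exp_mul_ofReal {r : ℂ} (hr : r.re = 0) (x : ℝ) : ‖Complex.exp (3 * r * x)‖ = 1 := by
  simp [Complex.norm_exp, hr]

lemma integrable_expCos_pow {d : ℕ} (hd : 2 ≤ d) :
    Integrable fun x : ℝ => (expCos (x / 2) * expCos (-(x / 2))) ^ (d - 1) := by
  refine (integrable_exp_mul_expCos_pow hd Complex.zero_re).norm.congr (ae_of_all _ fun x => ?_)
  have := expCos_pos (x / 2)
  have := expCos_pos (-(x / 2))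
  simp only
  rw [norm_mul, norm_exp_mul_ofReal Complex.zero_re, one_mul, Complex.norm_real,
    Real.norm_of_nonneg (by positivity)]

lemma integrable_zetaKernel_bound {d : ℕ} (hd : 2 ≤ d) : Integrable fun p : ℝ × ℝ =>
    Real.exp (-|p.1|) * (6 ^ d * (expCos (p.2 / 2) * expCos (-(p.2 / 2))) ^ (d - 1)) :=
  integrable_exp_neg_abs.mul_prod ((integrable_expCos_pow hd).const_mul _)

lemma norm_exp_mul_zetaKernel (d : ℕ) {r : ℂ} (hr : r.re = 0) (t a b x : ℝ) :
    ‖Complex.exp (3 * r * x) * zetaKernel d t a b‖ = zetaKernel d t a b := by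
  rw [norm_mul, norm_exp_mul_ofReal hr, one_mul, Complex.norm_real,
    Real.norm_of_nonneg (zetaKernel_pos d t a b).le]

lemma continuous_exp_mul_zetaKernel_scaled (d : ℕ) (r : ℂ) (t : ℝ) :
    Continuous fun p : ℝ × ℝ =>
      Complex.exp (3 * r * p.2) * zetaKernel d t (p.1 / -t) (p.1 / -t + p.2) := by
  have h := (continuous_zetaKernel d t).comp
    (by fun_prop : Continuous fun p : ℝ × ℝ => (p.1 / -t, p.1 / -t + p.2))
  simp only [Function.comp_def] at h
  fun_prop

lemma integrable_exp_mul_zetaKernel_scaled {d : ℕ} (hd : 2 ≤ d) {r : ℂ} (hr : r.re = 0) {t : ℝ}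
    (ht : 0 < t) : Integrable fun p : ℝ × ℝ =>
      Complex.exp (3 * r * p.2) * zetaKernel d t (p.1 / -t) (p.1 / -t + p.2) := by
  refine (integrable_zetaKernel_bound hd).mono'
    (continuous_exp_mul_zetaKernel_scaled d r t).aestronglyMeasurable (ae_of_all _ fun p => ?_)
  rw [norm_exp_mul_zetaKernel d hr]
  exact zetaKernel_le d ht _ _

lemma integrable_exp_mul_zetaKernel_shear {d : ℕ} (hd : 2 ≤ d) {r : ℂ} (hr : r.re = 0) {t : ℝ}
    (ht : 0 < t) : Integrable fun p : ℝ × ℝ =>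
      Complex.exp (3 * r * p.2) * zetaKernel d t p.1 (p.1 + p.2) := by
  have hb : Integrable fun p : ℝ × ℝ => Real.exp (-|p.1 * -t|) *
      (6 ^ d * (expCos (p.2 / 2) * expCos (-(p.2 / 2))) ^ (d - 1)) :=
    (integrable_exp_neg_abs.comp_mul_right' (neg_ne_zero.2 ht.ne')).mul_prod
      ((integrable_expCos_pow hd).const_mul _)
  refine hb.mono' ?_ (ae_of_all _ fun p => ?_)
  · have h := (continuous_zetaKernel d t).comp
      (by fun_prop : Continuous fun p : ℝ × ℝ => (p.1, p.1 + p.2))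
    simp only [Function.comp_def] at h
    exact Continuous.aestronglyMeasurable (by fun_prop)
  · rw [norm_exp_mul_zetaKernel d hr]
    have h := zetaKernel_le d ht (p.1 * -t) p.2
    rwa [mul_div_cancel_right₀ _ (neg_ne_zero.2 ht.ne')] at h

lemma exp_mul_zetaKernel_comp_shear (d : ℕ) (r : ℂ) (t : ℝ) (p : ℝ × ℝ) :
    Complex.exp (3 * r * ((p.1 + p.2 - p.1 : ℝ) : ℂ)) * zetaKernel d t p.1 (p.1 + p.2) =
      Complex.exp (3 * r * p.2) * zetaKernel d t p.1 (p.1 + p.2) := by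
  rw [add_sub_cancel_left]

lemma integrable_exp_mul_zetaKernel {d : ℕ} (hd : 2 ≤ d) {r : ℂ} (hr : r.re = 0) {t : ℝ}
    (ht : 0 < t) : Integrable fun p : ℝ × ℝ =>
      Complex.exp (3 * r * (p.2 - p.1 : ℝ)) * zetaKernel d t p.1 p.2 := by
  rw [Measure.volume_eq_prod, ← (measurePreserving_prod_add (volume : Measure ℝ)
    (volume : Measure ℝ)).integrable_comp_emb
    (MeasurableEquiv.shearAddRight ℝ).measurableEmbedding]
  exact (integrable_exp_mul_zetaKernel_shear hd hr ht).congr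
    (ae_of_all _ fun p => (exp_mul_zetaKernel_comp_shear d r t p).symm)

lemma mul_integral_exp_mul_zetaKernel {d : ℕ} (hd : 2 ≤ d) {r : ℂ} (hr : r.re = 0) {t : ℝ}
    (ht : 0 < t) :
    t * ∫ p : ℝ × ℝ, Complex.exp (3 * r * (p.2 - p.1 : ℝ)) * zetaKernel d t p.1 p.2 =
      ∫ p : ℝ × ℝ, Complex.exp (3 * r * p.2) * zetaKernel d t (p.1 / -t) (p.1 / -t + p.2) := by
  have h1 := (measurePreserving_prod_add (volume : Measure ℝ)
    (volume : Measure ℝ)).integral_comp (MeasurableEquiv.shearAddRight ℝ).measurableEmbedding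
    (fun p : ℝ × ℝ => Complex.exp (3 * r * (p.2 - p.1 : ℝ)) * (zetaKernel d t p.1 p.2 : ℂ))
  have h2 := Measure.integral_comp_div (fun a : ℝ => ∫ x : ℝ,
    Complex.exp (3 * r * x) * (zetaKernel d t a (a + x) : ℂ)) (-t)
  rw [abs_neg, abs_of_pos ht, Complex.real_smul] at h2
  rw [Measure.volume_eq_prod, ← h1,
    integral_congr_ae (ae_of_all _ (exp_mul_zetaKernel_comp_shear d r t)),
    integral_prod _ (integrable_exp_mul_zetaKernel_shear hd hr ht),
    integral_prod _ (integrable_exp_mul_zetaKernel_scaled hd hr ht)]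
  exact h2.symm

lemma tendsto_mul_integral_exp_mul_zetaKernel {d : ℕ} (hd : 2 ≤ d) {r : ℂ} (hr : r.re = 0) :
    Filter.Tendsto (fun t : ℝ =>
        t * ∫ p : ℝ × ℝ, Complex.exp (3 * r * (p.2 - p.1 : ℝ)) * zetaKernel d t p.1 p.2)
      (nhdsWithin 0 (Set.Ioi 0)) (nhds (3 / 2 * (4 ^ d / 2 ^ (d - 1)) *
        cBeta (((d : ℂ) - 1) / 2 - 3 * r) (((d : ℂ) - 1) / 2 + 3 * r))) := by
  have hlim : ∫ p : ℝ × ℝ, Complex.exp (3 * r * p.2) * ((heightLimit p.1 *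
      (4 ^ d * (expCos (p.2 / 2) * expCos (-(p.2 / 2)) / 2) ^ (d - 1)) : ℝ) : ℂ) =
      3 / 2 * (4 ^ d / 2 ^ (d - 1)) *
        cBeta (((d : ℂ) - 1) / 2 - 3 * r) (((d : ℂ) - 1) / 2 + 3 * r) := by
    rw [← integral_exp_mul_expCos_pow hd hr, mul_assoc, ← integral_const_mul]
    have e : (3 / 2 : ℂ) = ∫ v, (heightLimit v : ℂ) := by
      rw [integral_complex_ofReal, integral_heightLimit]; norm_num
    rw [e, ← integral_prod_mul]
    refine integral_congr_ae (ae_of_all _ fun p => ?_)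
    push_cast
    rw [div_pow]
    ring
  rw [← hlim]
  refine (tendsto_integral_filter_of_dominated_convergence
    (F := fun (t : ℝ) (p : ℝ × ℝ) =>
      Complex.exp (3 * r * p.2) * (zetaKernel d t (p.1 / -t) (p.1 / -t + p.2) : ℂ))
    _ ?_ ?_ (integrable_zetaKernel_bound hd) ?_).congr' ?_
  · exact Filter.Eventually.of_forall fun t =>
      (continuous_exp_mul_zetaKernel_scaled d r t).aestronglyMeasurable
  · filter_upwards [self_mem_nhdsWithin] with t ht
    refine ae_of_all _ fun p => ?_
    rw [norm_exp_mul_zetaKernel d hr]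
    exact zetaKernel_le d ht _ _
  · have h0 : ∀ᵐ p : ℝ × ℝ, p.1 ≠ 0 :=
      Measure.quasiMeasurePreserving_fst.ae (Measure.ae_ne volume (0 : ℝ))
    filter_upwards [h0] with p hp
    exact ((Complex.continuous_ofReal.tendsto _).comp (tendsto_zetaKernel p.2 hp)).const_mul _
  · filter_upwards [self_mem_nhdsWithin] with t ht
    exact (mul_integral_exp_mul_zetaKernel hd hr ht).symm

/-- The kernel obtained by summing products of two real Whittaker kernels over the weights. -/
noncomputable def pairKernel (d : ℕ) (a b : ℝ) : ℝ :=
  (expCos a * expCos b) ^ (((d : ℝ) + 1) / 2) *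
    (expCos (-a) * expCos (-b)) ^ (-(((d : ℝ) - 1) / 2)) *
    (angleFactor a b / (expCos a * expCos b)) ^ d

lemma add_two_add_inv_eq_angleFactor (a b : ℝ) :
    (1 + expCos (-a)) / expCos a * ((1 + expCos (-b)) / expCos b) + 2 +
      ((1 + expCos (-a)) / expCos a * ((1 + expCos (-b)) / expCos b))⁻¹ =
    angleFactor a b / (expCos a * expCos b) := by
  have ha := expCos_pos a
  have hb := expCos_pos b
  have ha' := expCos_pos (-a)
  have hb' := expCos_pos (-b)
  have e : ∀ x, ((1 + expCos (-x)) / expCos x)⁻¹ = (1 - expCos (-x)) / expCos x := fun x => by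
    have := expCos_pos x
    have := expCos_pos (-x)
    rw [inv_div, div_eq_div_iff (by positivity) (by positivity)]
    linear_combination expCos_sq_add_sq x
  rw [mul_inv, e, e, angleFactor]
  field_simp
  ring

lemma sum_choose_mul_whittakerKernel (d : ℕ) (x y a b : ℝ) :
    ∑ m' ∈ Finset.Icc (-(d : ℤ)) d, ((2 * d).choose (d + m'.natAbs) : ℝ) *
      (whittakerKernel d x y m' a * whittakerKernel d x y m' b) =
    pairKernel d a b * Real.exp (-(x * recipSum a b + y * recipSum (-a) (-b))) := by
  have ha := expCos_pos a
  have hb := expCos_pos b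
  have ha' := expCos_pos (-a)
  have hb' := expCos_pos (-b)
  have hz : (1 + expCos (-a)) / expCos a * ((1 + expCos (-b)) / expCos b) ≠ 0 := by positivity
  have h := sum_choose_mul_zpow d hz
  rw [add_two_add_inv_eq_angleFactor] at h
  have e : Real.exp (-(x * recipSum a b + y * recipSum (-a) (-b))) =
      Real.exp (-(x / expCos a + y / expCos (-a))) *
        Real.exp (-(x / expCos b + y / expCos (-b))) := by
    rw [← Real.exp_add, recipSum, recipSum]
    congr 1
    ring
  rw [pairKernel, ← h, e, Real.mul_rpow ha.le hb.le, Real.mul_rpow ha'.le hb'.le, Finset.mul_sum,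
    Finset.sum_mul]
  refine Finset.sum_congr rfl fun m' _ => ?_
  rw [whittakerKernel, whittakerKernel, mul_zpow]
  ring

lemma pairKernel_mul_rpow {d : ℕ} (hd : 1 ≤ d) (t a b : ℝ) :
    pairKernel d a b * (recipSum a b ^ (-((d : ℝ) - 1 + 2 * t)) *
      recipSum (-a) (-b) ^ (-((d : ℝ) - 1 + t))) = zetaKernel d t a b := by
  unfold pairKernel zetaKernel balance height
  have hP := mul_pos (expCos_pos a) (expCos_pos b)
  have hQ := mul_pos (expCos_pos (-a)) (expCos_pos (-b))
  have hA := angleFactor_pos a b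
  have hα := recipSum_pos a b
  have hβ := recipSum_pos (-a) (-b)
  generalize expCos a * expCos b = P at *
  generalize expCos (-a) * expCos (-b) = Q at *
  generalize angleFactor a b = A at *
  generalize recipSum a b = α at *
  generalize recipSum (-a) (-b) = β at *
  have hPQ := Real.sqrt_pos.2 (mul_pos hP hQ)
  refine Real.log_injOn_pos (Set.mem_Ioi.2 (by positivity)) (Set.mem_Ioi.2 (by positivity)) ?_
  rw [Real.log_mul (by positivity) (by positivity), Real.log_mul (by positivity) (by positivity),
    Real.log_mul (by positivity) (by positivity), Real.log_mul (by positivity) (by positivity),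
    Real.log_mul (by positivity) (by positivity), Real.log_mul (by positivity) (by positivity),
    Real.log_pow, Real.log_pow, Real.log_pow, Real.log_rpow hP, Real.log_rpow hQ,
    Real.log_rpow hα, Real.log_rpow hβ, Real.log_rpow (by positivity), Real.log_inv, Real.log_inv,
    Real.log_mul (by positivity) (by positivity), Real.log_mul (by positivity) (by positivity),
    Real.log_mul (by positivity) (by positivity), Real.log_sqrt (by positivity),
    Real.log_mul (by positivity) (by positivity), Real.log_div (by positivity) (by positivity),
    Real.log_pow]
  push_cast [hd]
  ring

lemma continuous_pairKernel (d : ℕ) : Continuous fun p : ℝ × ℝ => pairKernel d p.1 p.2 := by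
  have h := continuous_expCos
  unfold pairKernel angleFactor
  refine ((Continuous.rpow_const (by fun_prop) fun p => Or.inl ?_).mul
    (Continuous.rpow_const (by fun_prop) fun p => Or.inl ?_)).mul
    ((Continuous.div (by fun_prop) (by fun_prop) fun p => ?_).pow d)
  · exact (mul_pos (expCos_pos _) (expCos_pos _)).ne'
  · exact (mul_pos (expCos_pos _) (expCos_pos _)).ne'
  · exact (mul_pos (expCos_pos _) (expCos_pos _)).ne'

lemma cpow_half_sub_mul_cpow_half_add {x : ℝ} (hx : 0 < x) (d : ℕ) (r : ℂ) :
    (x : ℂ) ^ (((d : ℂ) + 1) / 2 - r) * (x : ℂ) ^ (((d : ℂ) + 1) / 2 + r) = (x : ℂ) ^ (d + 1) := by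
  rw [← cpow_add _ _ (by exact_mod_cast hx.ne'), ← cpow_natCast]
  congr 1
  push_cast
  ring

lemma sum_Wstar_mul_Wstar_neg (d : ℕ) {r : ℂ} (hr : r.re = 0) {y₁ y₂ : ℝ} (hy₁ : 0 < y₁)
    (hy₂ : 0 < y₂) :
    ∑ m' ∈ Finset.Icc (-(d : ℤ)) (d : ℤ), Wstar d r y₁ y₂ m' * Wstar d (-r) y₁ y₂ m' =
      4 * ((2 : ℂ) ^ (d + 1) * π)⁻¹ ^ 2 *
        (((2 * π * y₁ : ℝ) : ℂ) ^ (d + 1) * ((2 * π * y₂ : ℝ) : ℂ) ^ (d + 1)) *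
      ∫ p : ℝ × ℝ, Complex.exp (3 * r * (p.2 - p.1 : ℝ)) *
        ((pairKernel d p.1 p.2 * Real.exp (-(2 * π * y₁ * recipSum p.1 p.2 +
          2 * π * y₂ * recipSum (-p.1) (-p.2))) : ℝ) : ℂ) := by
  have hX : 0 < 2 * π * y₁ := by positivity
  have hY : 0 < 2 * π * y₂ := by positivity
  have hr' : (-r).re = 0 := by simp [hr]
  set X := 2 * π * y₁ with hXdef
  set Y := 2 * π * y₂ with hYdef
  have hterm : ∀ m' ∈ Finset.Icc (-(d : ℤ)) (d : ℤ),
      Wstar d r y₁ y₂ m' * Wstar d (-r) y₁ y₂ m' =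
      4 * ((2 : ℂ) ^ (d + 1) * π)⁻¹ ^ 2 * ((X : ℂ) ^ (d + 1) * (Y : ℂ) ^ (d + 1)) *
        ∫ p : ℝ × ℝ, ((2 * d).choose (d + m'.natAbs) : ℂ) *
          ((Complex.exp (-(3 * r * p.1)) * whittakerKernel d X Y m' p.1) *
            (Complex.exp (-(3 * -r * p.2)) * whittakerKernel d X Y m' p.2)) := by
    intro m' hm'
    rw [Finset.mem_Icc] at hm'
    have hm : m'.natAbs ≤ d := by lia
    rw [(Wstar_eq_integral hr hy₁ hy₂ hm).2, (Wstar_eq_integral hr' hy₁ hy₂ hm).2,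
      integral_const_mul, Measure.volume_eq_prod, integral_prod_mul
        (fun a : ℝ => Complex.exp (-(3 * r * a)) * (whittakerKernel d X Y m' a : ℂ))
        (fun b : ℝ => Complex.exp (-(3 * -r * b)) * (whittakerKernel d X Y m' b : ℂ)),
      ← cpow_half_sub_mul_cpow_half_add hX d r, ← cpow_half_sub_mul_cpow_half_add hY d r]
    have hsq : ((√((2 * d).choose (d + m'.natAbs)) : ℝ) : ℂ) ^ 2 =
        ((2 * d).choose (d + m'.natAbs) : ℂ) := by
      rw [← Complex.ofReal_pow, Real.sq_sqrt (Nat.cast_nonneg _), Complex.ofReal_natCast]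
    rw [← hsq, sub_neg_eq_add, ← sub_eq_add_neg]
    ring
  rw [Finset.sum_congr rfl hterm, ← Finset.mul_sum, ← integral_finsetSum]
  · congr 1
    refine integral_congr_ae (ae_of_all _ fun p => ?_)
    simp only
    rw [← sum_choose_mul_whittakerKernel, Complex.ofReal_sum, Finset.mul_sum]
    refine Finset.sum_congr rfl fun m' _ => ?_
    have e : Complex.exp (3 * r * (p.2 - p.1 : ℝ)) =
        Complex.exp (-(3 * r * p.1)) * Complex.exp (-(3 * -r * p.2)) := by
      rw [← Complex.exp_add]
      congr 1
      push_cast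
      ring
    rw [e]
    push_cast
    ring
  · intro m' hm'
    rw [Finset.mem_Icc] at hm'
    have hm : m'.natAbs ≤ d := by lia
    exact ((Wstar_eq_integral hr hy₁ hy₂ hm).1.mul_prod
      (Wstar_eq_integral hr' hy₁ hy₂ hm).1).const_mul _

lemma pow_mul_rpow_div_eq (d : ℕ) (t : ℝ) {c y₁ y₂ : ℝ} (hc : 0 < c) (hy₁ : 0 < y₁)
    (hy₂ : 0 < y₂) :
    (c * y₁) ^ (d + 1) * (c * y₂) ^ (d + 1) * ((y₁ ^ 2 * y₂) ^ t / (y₁ * y₂) ^ 3) =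
      c ^ (2 * (d + 1)) * (y₁ ^ ((d : ℝ) - 1 + 2 * t - 1) * y₂ ^ ((d : ℝ) - 1 + t - 1)) := by
  refine Real.log_injOn_pos (Set.mem_Ioi.2 (by positivity)) (Set.mem_Ioi.2 (by positivity)) ?_
  rw [Real.log_mul (by positivity) (by positivity), Real.log_mul (by positivity) (by positivity),
    Real.log_mul (by positivity) (by positivity), Real.log_mul (by positivity) (by positivity),
    Real.log_div (by positivity) (by positivity), Real.log_rpow (by positivity),
    Real.log_rpow (by positivity), Real.log_rpow (by positivity), Real.log_pow, Real.log_pow,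
    Real.log_pow, Real.log_pow, Real.log_mul (by positivity) (by positivity),
    Real.log_mul (by positivity) (by positivity), Real.log_mul (by positivity) (by positivity),
    Real.log_mul (by positivity) (by positivity), Real.log_pow]
  push_cast
  ring

lemma Psi_eq_integral {d : ℕ} (hd : 2 ≤ d) {r : ℂ} (hr : r.re = 0) {t : ℝ} (ht : 0 < t) :
    Psi d r (-r) t = 4 * ((2 : ℂ) ^ (d + 1) * π)⁻¹ ^ 2 * ((2 * π) ^ (2 * (d + 1)) *
      (Real.Gamma ((d : ℝ) - 1 + 2 * t) * Real.Gamma ((d : ℝ) - 1 + t)) *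
      (2 * π) ^ (-(2 * ((d : ℝ) - 1) + 3 * t)) : ℝ) *
      ∫ p : ℝ × ℝ, Complex.exp (3 * r * (p.2 - p.1 : ℝ)) * zetaKernel d t p.1 p.2 := by
  have hd' : (2 : ℝ) ≤ d := by exact_mod_cast hd
  have hπ : (0 : ℝ) < 2 * π := by positivity
  set C : ℂ := 4 * ((2 : ℂ) ^ (d + 1) * π)⁻¹ ^ 2 * ((2 * π) ^ (2 * (d + 1)) : ℝ) with hC
  set w : ℝ × ℝ → ℂ := fun p => Complex.exp (3 * r * (p.2 - p.1 : ℝ)) * pairKernel d p.1 p.2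
    with hw
  have hcp := continuous_pairKernel d
  have hcr := continuous_recipSum
  have hcr' : Continuous fun p : ℝ × ℝ => recipSum (-p.1) (-p.2) := hcr.comp continuous_neg
  have hker : ∀ p : ℝ × ℝ, w p * (((2 * π * recipSum p.1 p.2) ^ (-((d : ℝ) - 1 + 2 * t)) *
      (2 * π * recipSum (-p.1) (-p.2)) ^ (-((d : ℝ) - 1 + t)) : ℝ) : ℂ) =
      (((2 * π) ^ (-(2 * ((d : ℝ) - 1) + 3 * t)) : ℝ) : ℂ) *
        (Complex.exp (3 * r * (p.2 - p.1 : ℝ)) * zetaKernel d t p.1 p.2) := by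
    intro p
    have e : -(2 * ((d : ℝ) - 1) + 3 * t) = -((d : ℝ) - 1 + 2 * t) + -((d : ℝ) - 1 + t) := by ring
    rw [Real.mul_rpow hπ.le (recipSum_pos _ _).le, Real.mul_rpow hπ.le (recipSum_pos _ _).le,
      ← pairKernel_mul_rpow (by lia : 1 ≤ d), e, Real.rpow_add hπ, hw]
    push_cast
    ring
  have hinner : ∀ y₁ ∈ Set.Ioi (0 : ℝ), ∀ y₂ ∈ Set.Ioi (0 : ℝ),
      (∑ m' ∈ Finset.Icc (-(d : ℤ)) (d : ℤ), Wstar d r y₁ y₂ m' * Wstar d (-r) y₁ y₂ m') *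
      ((y₁ ^ 2 * y₂ : ℝ) : ℂ) ^ (t : ℂ) / ((y₁ * y₂ : ℝ) : ℂ) ^ 3 =
      C * ∫ p, w p * (((y₁ ^ ((d : ℝ) - 1 + 2 * t - 1) *
          Real.exp (-(2 * π * recipSum p.1 p.2 * y₁))) *
        (y₂ ^ ((d : ℝ) - 1 + t - 1) *
          Real.exp (-(2 * π * recipSum (-p.1) (-p.2) * y₂))) : ℝ) : ℂ) := by
    intro y₁ hy₁ y₂ hy₂
    rw [Set.mem_Ioi] at hy₁ hy₂
    have hcpow : ((y₁ ^ 2 * y₂ : ℝ) : ℂ) ^ (t : ℂ) = (((y₁ ^ 2 * y₂) ^ t : ℝ) : ℂ) :=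
      (Complex.ofReal_cpow (by positivity) t).symm
    have hpow := congrArg (fun x : ℝ => (x : ℂ)) (pow_mul_rpow_div_eq d t hπ hy₁ hy₂)
    have hint : ∀ p, w p * (((y₁ ^ ((d : ℝ) - 1 + 2 * t - 1) *
          Real.exp (-(2 * π * recipSum p.1 p.2 * y₁))) *
        (y₂ ^ ((d : ℝ) - 1 + t - 1) *
          Real.exp (-(2 * π * recipSum (-p.1) (-p.2) * y₂))) : ℝ) : ℂ) =
        ((y₁ ^ ((d : ℝ) - 1 + 2 * t - 1) * y₂ ^ ((d : ℝ) - 1 + t - 1) : ℝ) : ℂ) *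
        (Complex.exp (3 * r * (p.2 - p.1 : ℝ)) *
        ((pairKernel d p.1 p.2 * Real.exp (-(2 * π * y₁ * recipSum p.1 p.2 +
          2 * π * y₂ * recipSum (-p.1) (-p.2))) : ℝ) : ℂ)) := by
      intro p
      rw [mul_right_comm (2 * π) y₁, mul_right_comm (2 * π) y₂, neg_add, Real.exp_add, hw]
      push_cast
      ring
    rw [integral_congr_ae (ae_of_all _ hint), integral_const_mul,
      sum_Wstar_mul_Wstar_neg d hr hy₁ hy₂, hcpow, hC]
    generalize (∫ p : ℝ × ℝ, Complex.exp (3 * r * (p.2 - p.1 : ℝ)) *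
        ((pairKernel d p.1 p.2 * Real.exp (-(2 * π * y₁ * recipSum p.1 p.2 +
          2 * π * y₂ * recipSum (-p.1) (-p.2))) : ℝ) : ℂ)) = J
    generalize (y₁ ^ 2 * y₂) ^ t = T at *
    simp only [Complex.ofReal_mul, Complex.ofReal_div, Complex.ofReal_pow] at hpow ⊢
    linear_combination (4 * ((2 : ℂ) ^ (d + 1) * π)⁻¹ ^ 2 * J) * hpow
  have hmain := integral_Ioi_Ioi_integral_gammaKernel (ν := (volume : Measure (ℝ × ℝ)))
    (s₁ := (d : ℝ) - 1 + 2 * t) (s₂ := (d : ℝ) - 1 + t) (by linarith) (by linarith) (w := w)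
    (b₁ := fun p => 2 * π * recipSum p.1 p.2) (b₂ := fun p => 2 * π * recipSum (-p.1) (-p.2))
    (by fun_prop) (by fun_prop) (by fun_prop) (fun p => mul_pos hπ (recipSum_pos _ _))
    (fun p => mul_pos hπ (recipSum_pos _ _))
    (((integrable_exp_mul_zetaKernel hd hr ht).const_mul _).congr
      (ae_of_all _ fun p => (hker p).symm))
  rw [integral_congr_ae (ae_of_all _ hker), integral_const_mul] at hmain
  unfold Psi
  rw [setIntegral_congr_fun measurableSet_Ioi fun y₁ hy₁ =>
    setIntegral_congr_fun measurableSet_Ioi (hinner y₁ hy₁)]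
  simp_rw [integral_const_mul]
  rw [hmain, hC]
  push_cast
  ring

/-- The limit `lim_{t → 0⁺} t · Ψ^d(r, -r, t)`. -/
theorem residue_of_Psi (d : ℕ) (hd : 2 ≤ d) (r : ℂ) (hr : r.re = 0) :
    Filter.Tendsto (fun t : ℝ => (t : ℂ) * Psi d r (-r) (t : ℂ))
      (nhdsWithin 0 (Set.Ioi 0))
      (nhds (3 * (2 : ℂ) ^ (4 - (d : ℂ)) * (Real.pi : ℂ) ^ 2 *
        Complex.Gamma ((d : ℂ) - 1) * Complex.Gamma (((d : ℂ) - 1) / 2 - 3 * r) *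
          Complex.Gamma (((d : ℂ) - 1) / 2 + 3 * r))) := by
  have hd' : (2 : ℝ) ≤ d := by exact_mod_cast hd
  have hπ : (0 : ℝ) < 2 * π := by positivity
  have hΓ : ContinuousAt Real.Gamma ((d : ℝ) - 1) := by
    refine (Real.differentiableAt_Gamma fun m => ?_).continuousAt
    have : (0 : ℝ) ≤ m := Nat.cast_nonneg m
    intro h
    linarith
  have hlin : ∀ k : ℝ, Filter.Tendsto (fun t : ℝ => (d : ℝ) - 1 + k * t)
      (nhdsWithin 0 (Set.Ioi 0)) (nhds ((d : ℝ) - 1)) := fun k => by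
    have h : Continuous fun t : ℝ => (d : ℝ) - 1 + k * t := by fun_prop
    have h0 := h.tendsto 0
    rw [mul_zero, add_zero] at h0
    exact h0.mono_left nhdsWithin_le_nhds
  have hrpow : Filter.Tendsto (fun t : ℝ => (2 * π) ^ (-(2 * ((d : ℝ) - 1) + 3 * t)))
      (nhdsWithin 0 (Set.Ioi 0)) (nhds ((2 * π) ^ (-(2 * ((d : ℝ) - 1))))) := by
    have h : Continuous fun t : ℝ => (2 * π) ^ (-(2 * ((d : ℝ) - 1) + 3 * t)) :=
      Continuous.rpow continuous_const (by fun_prop) fun t => Or.inl hπ.ne'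
    have h0 := h.tendsto 0
    rw [mul_zero, add_zero] at h0
    exact h0.mono_left nhdsWithin_le_nhds
  have hG2 := hΓ.tendsto.comp (hlin 2)
  have hG1 := hΓ.tendsto.comp (hlin 1)
  have hscal := ((hG2.mul hG1).const_mul ((2 * π) ^ (2 * (d + 1)))).mul hrpow
  have hall := (((Complex.continuous_ofReal.tendsto _).comp hscal).const_mul
    (4 * ((2 : ℂ) ^ (d + 1) * π)⁻¹ ^ 2)).mul (tendsto_mul_integral_exp_mul_zetaKernel hd hr)
  have hval : 4 * ((2 : ℂ) ^ (d + 1) * π)⁻¹ ^ 2 * (((2 * π) ^ (2 * (d + 1)) *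
      (Real.Gamma ((d : ℝ) - 1) * Real.Gamma ((d : ℝ) - 1)) *
      (2 * π) ^ (-(2 * ((d : ℝ) - 1))) : ℝ) : ℂ) * (3 / 2 * (4 ^ d / 2 ^ (d - 1)) *
        cBeta (((d : ℂ) - 1) / 2 - 3 * r) (((d : ℂ) - 1) / 2 + 3 * r)) =
      3 * (2 : ℂ) ^ (4 - (d : ℂ)) * (π : ℂ) ^ 2 *
        Complex.Gamma ((d : ℂ) - 1) * Complex.Gamma (((d : ℂ) - 1) / 2 - 3 * r) *
          Complex.Gamma (((d : ℂ) - 1) / 2 + 3 * r) := by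
    obtain ⟨n, rfl⟩ : ∃ n, d = n + 1 := ⟨d - 1, by lia⟩
    have e1 : (2 * π) ^ (-(2 * (((n + 1 : ℕ) : ℝ) - 1))) = ((2 * π) ^ (2 * n))⁻¹ := by
      rw [← Real.rpow_natCast, ← Real.rpow_neg hπ.le]
      push_cast
      ring_nf
    have e2 : (2 : ℂ) ^ (4 - ((n + 1 : ℕ) : ℂ)) = 2 ^ 4 / 2 ^ (n + 1) := by
      rw [cpow_sub _ _ two_ne_zero, cpow_natCast]
      norm_cast
    have e3 : ((n + 1 : ℕ) : ℂ) - 1 = ((((n + 1 : ℕ) : ℝ) - 1 : ℝ) : ℂ) := by push_cast; ring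
    have e4 : (((n + 1 : ℕ) : ℂ) - 1) / 2 - 3 * r + ((((n + 1 : ℕ) : ℂ) - 1) / 2 + 3 * r) =
        ((n + 1 : ℕ) : ℂ) - 1 := by ring
    have hG : (Real.Gamma (((n + 1 : ℕ) : ℝ) - 1) : ℂ) ≠ 0 :=
      Complex.ofReal_ne_zero.2 (Real.Gamma_pos_of_pos (by linarith)).ne'
    have h4 : (4 : ℂ) ^ (n + 1) = 2 ^ (n + 1) * 2 ^ (n + 1) := by rw [← mul_pow]; norm_num
    rw [cBeta, e4, e1, e2, e3, Complex.Gamma_ofReal, h4, Nat.add_sub_cancel]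
    have hπ' : (π : ℂ) ≠ 0 := by exact_mod_cast Real.pi_ne_zero
    push_cast
    field_simp
    ring
  rw [← hval]
  refine hall.congr' ?_
  filter_upwards [self_mem_nhdsWithin] with t ht
  rw [Psi_eq_integral hd hr ht]
  simp only [Function.comp_apply, one_mul]
  ring
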